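/- arXiv:2308.16318 — 13 statements merged into one kernel-verified Lean document; each statement's English description precedes it below -/
import Mathlib

section
/- For every real number t with -1 ≤ t ≤ 1 and every real number x with |x| < 1, one has 1 - 2xt + x² > 0 and the series ∑_{n=0}^∞ Pₙ(t)·xⁿ converges to 1/√(1 - 2xt + x²). -/
/-- The Legendre polynomials (as functions `ℝ → ℝ`), defined by the recurrence
`P₀(t) = 1`, `P₁(t) = t`, `(n+1)·P_{n+1}(t) = (2n+1)·t·Pₙ(t) − n·P_{n−1}(t)`. -/
noncomputable def legendreP : ℕ → ℝ → ℝ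
  | 0, _ => 1
  | 1, t => t
  | (n + 2), t =>
      ((2 * (n + 1 : ℝ) + 1) * t * legendreP (n + 1) t - (n + 1 : ℝ) * legendreP n t)
        / ((n + 1 : ℝ) + 1)

theorem legendreP_zero (t : ℝ) : legendreP 0 t = 1 := by rw [legendreP]

theorem legendreP_one (t : ℝ) : legendreP 1 t = t := by rw [legendreP]

theorem legendreP_succ_succ_mul (n : ℕ) (t : ℝ) :
    ((n : ℝ) + 2) * legendreP (n + 2) t =
      (2 * (n : ℝ) + 3) * t * legendreP (n + 1) t - ((n : ℝ) + 1) * legendreP n t := by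
  have h : (n : ℝ) + 1 + 1 ≠ 0 := by positivity
  rw [legendreP]
  field_simp
  ring

/-- A quadratic form in consecutive Legendre values that is nonincreasing in `n`. -/
theorem legendreP_energy_le (n : ℕ) (t : ℝ) :
    (1 - t ^ 2) * legendreP n t ^ 2 + (legendreP (n + 1) t - t * legendreP n t) ^ 2 ≤
      1 - t ^ 2 := by
  induction n with
  | zero => simp [legendreP_zero, legendreP_one]
  | succ n ih =>
    refine le_trans ?_ ih
    have hn : (0 : ℝ) ≤ n := n.cast_nonneg
    have hstep : legendreP (n + 2) t - t * legendreP (n + 1) t =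
        ((n + 1) / (n + 2)) * (t * legendreP (n + 1) t - legendreP n t) := by
      have := legendreP_succ_succ_mul n t
      field_simp
      linear_combination this
    have hc : (((n : ℝ) + 1) / (n + 2)) ^ 2 ≤ 1 := by
      refine pow_le_one₀ (by positivity) ?_
      rw [div_le_one (by positivity)]
      linarith
    rw [hstep, mul_pow]
    nlinarith [mul_le_mul_of_nonneg_right hc
      (sq_nonneg (t * legendreP (n + 1) t - legendreP n t))]

theorem abs_legendreP_le_one (n : ℕ) {t : ℝ} (ht : |t| ≤ 1) : |legendreP n t| ≤ 1 := by
  have ht2 : t ^ 2 ≤ 1 := (sq_le_one_iff_abs_le_one t).2 ht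
  rcases ht2.lt_or_eq with h | h
  · rw [← sq_le_one_iff_abs_le_one]
    nlinarith [legendreP_energy_le n t,
      sq_nonneg (legendreP (n + 1) t - t * legendreP n t)]
  · induction n with
    | zero => simp [legendreP_zero]
    | succ n ih =>
      have h0 : legendreP (n + 1) t - t * legendreP n t = 0 := by
        have := legendreP_energy_le n t
        rw [h] at this
        exact pow_eq_zero_iff two_ne_zero |>.1 (le_antisymm (by linarith) (sq_nonneg _))
      rw [sub_eq_zero.1 h0, abs_mul]
      exact mul_le_one₀ ht (abs_nonneg _) ih

theorem summable_mul_pow_of_abs_le_one {a : ℕ → ℝ} (ha : ∀ n, |a n| ≤ 1) {x : ℝ}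
    (hx : |x| < 1) : Summable fun n => a n * x ^ n := by
  refine Summable.of_norm_bounded (summable_geometric_of_lt_one (abs_nonneg x) hx) fun n => ?_
  rw [Real.norm_eq_abs, abs_mul, abs_pow]
  exact mul_le_of_le_one_left (by positivity) (ha n)

theorem abs_deriv_term_le {a : ℕ → ℝ} (ha : ∀ n, |a n| ≤ 1) {x r : ℝ} (hx : |x| ≤ r) (n : ℕ) :
    ‖a n * (n * x ^ (n - 1))‖ ≤ n * r ^ (n - 1) := by
  rw [Real.norm_eq_abs, abs_mul, abs_mul, abs_pow, Nat.abs_cast]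
  calc |a n| * (n * |x| ^ (n - 1)) ≤ 1 * (n * |x| ^ (n - 1)) := by gcongr; exact ha n
    _ ≤ n * r ^ (n - 1) := by rw [one_mul]; gcongr

theorem summable_nat_mul_pow_pred {r : ℝ} (hr : |r| < 1) :
    Summable fun n : ℕ => (n : ℝ) * r ^ (n - 1) := by
  rw [← summable_nat_add_iff 1]
  have h := (summable_pow_mul_geometric_of_norm_lt_one 1 (r := r) hr).add
    (summable_geometric_of_abs_lt_one hr)
  refine h.congr fun n => ?_
  simp only [Nat.add_sub_cancel]
  push_cast
  ring

theorem hasDerivAt_tsum_mul_pow {a : ℕ → ℝ} (ha : ∀ n, |a n| ≤ 1) {x : ℝ} (hx : |x| < 1) :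
    HasDerivAt (fun y => ∑' n, a n * y ^ n) (∑' n : ℕ, a n * (n * x ^ (n - 1))) x := by
  obtain ⟨r, hxr, hr⟩ := exists_between hx
  have hr0 : 0 < r := (abs_nonneg x).trans_lt hxr
  refine hasDerivAt_tsum_of_isPreconnected (t := Metric.ball 0 r)
    (g := fun n y => a n * y ^ n) (g' := fun n y => a n * (n * y ^ (n - 1)))
    (summable_nat_mul_pow_pred (by rwa [abs_of_pos hr0]))
    Metric.isOpen_ball (convex_ball 0 r).isPreconnected
    (fun n y _ => (hasDerivAt_pow n y).const_mul (a n))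
    (fun n y hy => abs_deriv_term_le ha (by simpa using (mem_ball_zero_iff.1 hy).le) n)
    (Metric.mem_ball_self hr0) (summable_mul_pow_of_abs_le_one ha (by simp))
    (by simpa using hxr)

/-- The differential equation of the Legendre generating function. -/
theorem legendreP_tsum_ode {t x : ℝ} (ht : |t| ≤ 1) (hx : |x| < 1) :
    (1 - 2 * x * t + x ^ 2) * (∑' n : ℕ, legendreP n t * (n * x ^ (n - 1))) =
      (t - x) * ∑' n, legendreP n t * x ^ n := by
  have ha := fun n => abs_legendreP_le_one n ht
  have hG := (summable_mul_pow_of_abs_le_one ha hx).hasSum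
  have hD := (Summable.of_norm_bounded (summable_nat_mul_pow_pred (r := |x|) (by simpa using hx))
    (abs_deriv_term_le ha le_rfl)).hasSum
  set G := ∑' n, legendreP n t * x ^ n
  set D := ∑' n : ℕ, legendreP n t * (n * x ^ (n - 1))
  have hG1 := (hasSum_nat_add_iff' 1).2 hG
  have hD1 := (hasSum_nat_add_iff' 1).2 hD
  have hD2 := (hasSum_nat_add_iff' 2).2 hD
  simp only [Finset.sum_range_succ, Finset.sum_range_zero, legendreP_zero, legendreP_one,
    zero_add] at hG1 hD1 hD2
  have hxD : HasSum (fun n : ℕ => legendreP n t * (n * x ^ n)) (x * D) := by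
    refine (hD.mul_left x).congr_fun fun n => ?_
    cases n with
    | zero => simp
    | succ n => simp only [Nat.add_sub_cancel]; ring
  have key := (((hD1.mul_left (2 * t * x)).add (hG1.mul_left t)).sub
    ((hxD.add hG).mul_left x)).unique (hD2.congr_fun fun n => ?_)
  · norm_num at key
    linear_combination -key
  · have h := legendreP_succ_succ_mul n t
    simp only [Nat.add_sub_cancel, show n + 2 - 1 = n + 1 from rfl]
    push_cast
    linear_combination (-x ^ (n + 1)) * h

theorem one_sub_two_mul_add_sq_pos {t x : ℝ} (ht : |t| ≤ 1) (hx : |x| < 1) :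
    0 < 1 - 2 * x * t + x ^ 2 := by
  have h1 : x * t ≤ |x| :=
    (le_abs_self _).trans ((abs_mul x t).le.trans (mul_le_of_le_one_right (abs_nonneg x) ht))
  nlinarith [sq_abs x, mul_pos (sub_pos.2 hx) (sub_pos.2 hx)]

theorem legendreP_tsum_mul_sqrt {t x : ℝ} (ht : |t| ≤ 1) (hx : |x| < 1) :
    (∑' n, legendreP n t * x ^ n) * Real.sqrt (1 - 2 * x * t + x ^ 2) = 1 := by
  set F : ℝ → ℝ := fun y =>
    (∑' n, legendreP n t * y ^ n) * Real.sqrt (1 - 2 * y * t + y ^ 2)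
  have hF : ∀ y ∈ Metric.ball (0 : ℝ) 1, HasDerivAt F 0 y := by
    intro y hy
    have hy1 : |y| < 1 := by simpa using hy
    have hq := one_sub_two_mul_add_sq_pos ht hy1
    have hq' : HasDerivAt (fun y : ℝ => 1 - 2 * y * t + y ^ 2) (2 * (y - t)) y := by
      have h := ((((hasDerivAt_id y).const_mul 2).mul_const t).const_sub 1).add
        (hasDerivAt_pow 2 y)
      refine h.congr_deriv ?_
      norm_num
      ring
    refine ((hasDerivAt_tsum_mul_pow (fun n => abs_legendreP_le_one n ht) hy1).mul
      (hq'.sqrt hq.ne')).congr_deriv ?_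
    have hs := Real.sqrt_pos.2 hq
    have hode := legendreP_tsum_ode ht hy1
    rw [← Real.sq_sqrt hq.le] at hode
    generalize (∑' n : ℕ, legendreP n t * (n * y ^ (n - 1))) = D at hode ⊢
    field_simp
    linear_combination hode
  have hconst : F x = F 0 :=
    Metric.isOpen_ball.is_const_of_deriv_eq_zero (convex_ball 0 1).isPreconnected
      (fun y hy => (hF y hy).differentiableAt.differentiableWithinAt)
      (fun y hy => (hF y hy).deriv) (by simpa using hx) (Metric.mem_ball_self one_pos)
  have h0 : ∑' n, legendreP n t * (0 : ℝ) ^ n = 1 := by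
    rw [tsum_eq_single 0 fun n hn => by simp [hn]]
    simp [legendreP_zero]
  change F x = 1
  rw [hconst]
  simp [F, h0]

theorem legendre_generating_function (t x : ℝ) (ht : -1 ≤ t) (ht' : t ≤ 1)
    (hx : |x| < 1) :
    1 - 2 * x * t + x ^ 2 > 0 ∧
      HasSum (fun n : ℕ => legendreP n t * x ^ n)
        (1 / Real.sqrt (1 - 2 * x * t + x ^ 2)) := by
  have hta : |t| ≤ 1 := abs_le.2 ⟨ht, ht'⟩
  have hq := one_sub_two_mul_add_sq_pos hta hx
  refine ⟨hq, ?_⟩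
  rw [← eq_one_div_of_mul_eq_one_left (legendreP_tsum_mul_sqrt hta hx)]
  exact (summable_mul_pow_of_abs_le_one (fun n => abs_legendreP_le_one n hta) hx).hasSum
end

section
/- Let a be a real number with |a| < 1, let i be a natural number, and for a natural number m set A_m(a,i) = ∫₀^π cos(iφ)/(1 + a² − 2a·cos φ)^m dφ. Then for every natural number n ≥ 1, n(n−1)(1−a²)²·A_{n+1}(a,i) = (n−1)(2n−1)(1+a²)·A_n(a,i) + (i² − (n−1)²)·A_{n−1}(a,i). -/
open intervalIntegral Real

lemma one_add_sq_sub_two_mul_cos_pos {a : ℝ} (ha : |a| < 1) (φ : ℝ) :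
    0 < 1 + a ^ 2 - 2 * a * Real.cos φ := by
  have h : 0 < 1 - a * Real.cos φ := by
    have hle : |a * Real.cos φ| ≤ |a| := by
      rw [abs_mul]
      exact mul_le_of_le_one_right (abs_nonneg a) (Real.abs_cos_le_one φ)
    linarith [le_abs_self (a * Real.cos φ)]
  nlinarith [sq_nonneg (a * Real.sin φ), Real.sin_sq_add_cos_sq φ, mul_pos h h]

lemma hasDerivAt_inv_pow {D : ℝ → ℝ} {D' x : ℝ} (hD : HasDerivAt D D' x) (hx : D x ≠ 0)
    (m : ℕ) : HasDerivAt (fun y => (D y ^ m)⁻¹) (-(m * D') / D x ^ (m + 1)) x := by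
  refine ((hD.fun_pow m).fun_inv (pow_ne_zero m hx)).congr_deriv ?_
  cases m with
  | zero => simp
  | succ k =>
    rw [Nat.add_sub_cancel]
    field_simp
    ring

lemma hasDerivAt_euler_primitive {a : ℝ} (ha : |a| < 1) (i m : ℕ) (φ : ℝ) :
    HasDerivAt (fun x : ℝ => Real.cos (i * x) *
        (-(m * (2 * a * Real.sin x)) * ((1 + a ^ 2 - 2 * a * Real.cos x) ^ (m + 1))⁻¹) +
        i * Real.sin (i * x) * ((1 + a ^ 2 - 2 * a * Real.cos x) ^ m)⁻¹)
      (-((m + 1) * m * (1 - a ^ 2) ^ 2) *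
          (Real.cos (i * φ) / (1 + a ^ 2 - 2 * a * Real.cos φ) ^ (m + 2)) +
        m * (2 * m + 1) * (1 + a ^ 2) *
          (Real.cos (i * φ) / (1 + a ^ 2 - 2 * a * Real.cos φ) ^ (m + 1)) +
        ((i : ℝ) ^ 2 - (m : ℝ) ^ 2) *
          (Real.cos (i * φ) / (1 + a ^ 2 - 2 * a * Real.cos φ) ^ m)) φ := by
  have hne := (one_add_sq_sub_two_mul_cos_pos ha φ).ne'
  have hD : HasDerivAt (fun x : ℝ => 1 + a ^ 2 - 2 * a * Real.cos x)
      (2 * a * Real.sin φ) φ := by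
    simpa using ((Real.hasDerivAt_cos φ).const_mul (2 * a)).const_sub (1 + a ^ 2)
  have hlin : HasDerivAt (fun x : ℝ => (i : ℝ) * x) i φ := by
    simpa using (hasDerivAt_id φ).const_mul (i : ℝ)
  have hsin := ((Real.hasDerivAt_sin φ).const_mul (2 * a)).const_mul (m : ℝ)
  refine ((hlin.cos.mul (hsin.fun_neg.mul (hasDerivAt_inv_pow hD hne (m + 1)))).add
    ((hlin.sin.const_mul (i : ℝ)).mul (hasDerivAt_inv_pow hD hne m))).congr_deriv ?_
  have hs : Real.sin φ ^ 2 = 1 - Real.cos φ ^ 2 := Real.sin_sq φ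
  simp only [Pi.mul_apply, Nat.cast_add, Nat.cast_one]
  generalize Real.cos (i * φ) = C
  generalize Real.sin (i * φ) = S
  generalize hE : 1 + a ^ 2 - 2 * a * Real.cos φ = E at hne ⊢
  have hc : 2 * a * Real.cos φ = 1 + a ^ 2 - E := by linarith
  have hs' : (2 * a * Real.sin φ) ^ 2 =
      -(1 - a ^ 2) ^ 2 + 2 * (1 + a ^ 2) * E - E ^ 2 := by
    rw [mul_pow, hs]
    linear_combination (-(2 * a * Real.cos φ) - (1 + a ^ 2 - E)) * hc
  rw [hc]
  generalize 2 * a * Real.sin φ = s at hs' ⊢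
  have hE2 : E ^ (m + 1 + 1) = E ^ m * E ^ 2 := pow_add E m 2
  have hE1 : E ^ (m + 1) = E ^ m * E := pow_succ ..
  have hEm : E ^ m ≠ 0 := pow_ne_zero m hne
  rw [hE2, hE1]
  generalize E ^ m = P at hEm
  field_simp
  linear_combination C * m * (m + 1) * hs'

theorem euler_difference_equation (a : ℝ) (ha : |a| < 1) (i : ℕ)
    (A : ℕ → ℝ)
    (hA : ∀ m : ℕ, A m =
      ∫ φ in (0:ℝ)..Real.pi, Real.cos (i * φ) / (1 + a ^ 2 - 2 * a * Real.cos φ) ^ m)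
    (n : ℕ) (hn : 1 ≤ n) :
    (n : ℝ) * ((n : ℝ) - 1) * (1 - a ^ 2) ^ 2 * A (n + 1) =
      ((n : ℝ) - 1) * (2 * (n : ℝ) - 1) * (1 + a ^ 2) * A n +
        ((i : ℝ) ^ 2 - ((n : ℝ) - 1) ^ 2) * A (n - 1) := by
  obtain ⟨m, rfl⟩ := Nat.exists_eq_add_of_le' hn
  have hint (k : ℕ) (c : ℝ) : IntervalIntegrable (fun φ : ℝ => c *
      (Real.cos (i * φ) / (1 + a ^ 2 - 2 * a * Real.cos φ) ^ k)) MeasureTheory.volume 0 Real.pi :=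
    (continuous_const.mul (Continuous.div (by fun_prop) (by fun_prop) fun φ =>
      pow_ne_zero k (one_add_sq_sub_two_mul_cos_pos ha φ).ne')).intervalIntegrable _ _
  have key := integral_eq_sub_of_hasDerivAt (a := 0) (b := Real.pi)
    (fun φ _ => hasDerivAt_euler_primitive ha i m φ)
    (((hint _ _).add (hint _ _)).add (hint _ _))
  rw [integral_add ((hint _ _).add (hint _ _)) (hint _ _), integral_add (hint _ _) (hint _ _),
    integral_const_mul, integral_const_mul, integral_const_mul, ← hA, ← hA, ← hA] at key
  simp only [Real.sin_nat_mul_pi, Real.sin_pi, Real.sin_zero, mul_zero, neg_zero, zero_mul,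
    add_zero, sub_zero] at key
  rw [Nat.add_sub_cancel]
  push_cast
  linear_combination -key
end

section
/- Let a be a real number with |a| < 1 and let n, i be natural numbers. Then C(n+i, i)·(1−a²)^{−n}·∫₀^π (1 + a² − 2a·cos φ)ⁿ·cos(iφ) dφ = (−1)^i·C(n, i)·(1−a²)^{n+1}·∫₀^π cos(iφ)/(1 + a² − 2a·cos φ)^{n+1} dφ, where C(·,·) denotes the binomial coefficient. -/
open intervalIntegral Real

/-- The cosine moments `∫₀^π (1 + a² - 2a cos φ)ᵐ cos (iφ) dφ` for integers `m` and `i`. -/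
noncomputable def cosMoment (a : ℝ) (m i : ℤ) : ℝ :=
  ∫ φ in (0 : ℝ)..π, (1 + a ^ 2 - 2 * a * cos φ) ^ m * cos (i * φ)

lemma one_sub_mul_cos_pos {a : ℝ} (ha : |a| < 1) (φ : ℝ) : 0 < 1 - a * cos φ := by
  have h : |a * cos φ| ≤ |a| := by
    rw [abs_mul]
    exact mul_le_of_le_one_right (abs_nonneg a) (abs_cos_le_one φ)
  linarith [le_abs_self (a * cos φ)]

lemma one_add_sq_sub_pos {a : ℝ} (ha : |a| < 1) (φ : ℝ) :
    0 < 1 + a ^ 2 - 2 * a * cos φ := by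
  nlinarith [sq_pos_of_pos (one_sub_mul_cos_pos ha φ), sq_nonneg (a * sin φ), sin_sq_add_cos_sq φ]

lemma continuous_cosMoment_weight {a : ℝ} (ha : |a| < 1) (m : ℤ) :
    Continuous fun φ : ℝ => (1 + a ^ 2 - 2 * a * cos φ) ^ m :=
  Continuous.zpow₀ (by fun_prop) m fun φ => Or.inl (one_add_sq_sub_pos ha φ).ne'

lemma intervalIntegrable_cosMoment {a : ℝ} (ha : |a| < 1) (m i : ℤ) :
    IntervalIntegrable (fun φ : ℝ => (1 + a ^ 2 - 2 * a * cos φ) ^ m * cos (i * φ))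
      MeasureTheory.volume 0 π :=
  ((continuous_cosMoment_weight ha m).mul (by fun_prop)).intervalIntegrable _ _

lemma cosMoment_neg (a : ℝ) (m i : ℤ) : cosMoment a m (-i) = cosMoment a m i := by
  simp [cosMoment]

lemma cosMoment_succ {a : ℝ} (ha : |a| < 1) (m i : ℤ) :
    cosMoment a (m + 1) i =
      (1 + a ^ 2) * cosMoment a m i - a * (cosMoment a m (i - 1) + cosMoment a m (i + 1)) := by
  have hint := intervalIntegrable_cosMoment ha m
  unfold cosMoment
  rw [← integral_add (hint _) (hint _), ← integral_const_mul, ← integral_const_mul,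
    ← integral_sub ((hint _).const_mul _) (((hint _).add (hint _)).const_mul _)]
  refine integral_congr fun φ _ => ?_
  rw [zpow_add_one₀ (one_add_sq_sub_pos ha φ).ne']
  push_cast
  rw [sub_mul (i : ℝ), add_mul (i : ℝ), one_mul, cos_sub, cos_add]
  ring

lemma mul_cosMoment_succ {a : ℝ} (ha : |a| < 1) (m i : ℤ) :
    i * cosMoment a (m + 1) i =
      (m + 1) * (a * (cosMoment a m (i + 1) - cosMoment a m (i - 1))) := by
  have hint := intervalIntegrable_cosMoment ha
  have hderiv (φ : ℝ) : HasDerivAt (fun φ : ℝ => (1 + a ^ 2 - 2 * a * cos φ) ^ (m + 1) * sin (i * φ))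
      (i * ((1 + a ^ 2 - 2 * a * cos φ) ^ (m + 1) * cos (i * φ)) -
        (m + 1) * (a * ((1 + a ^ 2 - 2 * a * cos φ) ^ m * cos ((i + 1 : ℤ) * φ) -
          (1 + a ^ 2 - 2 * a * cos φ) ^ m * cos ((i - 1 : ℤ) * φ)))) φ := by
    have h₁ : HasDerivAt (fun φ : ℝ => 1 + a ^ 2 - 2 * a * cos φ) (2 * a * sin φ) φ := by
      simpa using ((hasDerivAt_cos φ).const_mul (2 * a)).const_sub (1 + a ^ 2)
    have h₂ := (hasDerivAt_zpow (m + 1) _ (Or.inl (one_add_sq_sub_pos ha φ).ne')).comp φ h₁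
    have h₃ : HasDerivAt (fun φ : ℝ => sin (i * φ)) (cos (i * φ) * i) φ := by
      simpa using ((hasDerivAt_id φ).const_mul (i : ℝ)).sin
    refine (h₂.mul h₃).congr_deriv ?_
    push_cast
    rw [sub_mul (i : ℝ), add_mul (i : ℝ), one_mul, cos_sub, cos_add, add_sub_cancel_right, Function.comp_apply]
    ring
  have hdiff := ((hint m (i + 1)).sub (hint m (i - 1))).const_mul a |>.const_mul (m + 1 : ℝ)
  have hmain := integral_eq_sub_of_hasDerivAt (fun φ _ => hderiv φ)
    (((hint (m + 1) i).const_mul (i : ℝ)).sub hdiff)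
  rw [integral_sub ((hint (m + 1) i).const_mul (i : ℝ)) hdiff, integral_const_mul,
    integral_const_mul, integral_const_mul, integral_sub (hint _ _) (hint _ _)] at hmain
  simp only [sin_int_mul_pi, mul_zero, sin_zero, sub_zero] at hmain
  exact sub_eq_zero.mp hmain

lemma cosMoment_raise {a : ℝ} (ha : |a| < 1) (m i : ℤ) :
    (i + m + 1) * cosMoment a (m + 1) i =
      (m + 1) * ((1 + a ^ 2) * cosMoment a m i - 2 * a * cosMoment a m (i - 1)) := by
  linear_combination (m + 1 : ℝ) * cosMoment_succ ha m i + mul_cosMoment_succ ha m i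

lemma cosMoment_lower {a : ℝ} (ha : |a| < 1) (m i : ℤ) :
    (m + 1) * (1 - a ^ 2) ^ 2 * cosMoment a m i =
      (1 + a ^ 2) * (m + 1 + i) * cosMoment a (m + 1) i +
        2 * a * (m + 2 - i) * cosMoment a (m + 1) (i - 1) := by
  have h := cosMoment_raise ha m (1 - i)
  rw [show (1 - i - 1 : ℤ) = -i by ring, show (1 - i : ℤ) = -(i - 1) by ring] at h
  simp only [cosMoment_neg] at h
  push_cast at h
  linear_combination -(1 + a ^ 2) * cosMoment_raise ha m i - 2 * a * h

lemma cosMoment_zero_of_ne_zero (a : ℝ) {i : ℤ} (hi : i ≠ 0) : cosMoment a 0 i = 0 := by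
  have hi' : (i : ℝ) ≠ 0 := by exact_mod_cast hi
  simp [cosMoment, integral_comp_mul_left _ hi', sin_int_mul_pi]

lemma cosMoment_neg_one_zero {a : ℝ} (ha : |a| < 1) :
    (1 - a ^ 2) * cosMoment a (-1) 0 = π := by
  have hderiv (φ : ℝ) : HasDerivAt (fun φ : ℝ => 2 * arctan (a * sin φ / (1 - a * cos φ)) + φ)
      ((1 - a ^ 2) * ((1 + a ^ 2 - 2 * a * cos φ) ^ (-1 : ℤ) * cos ((0 : ℤ) * φ))) φ := by
    have hd := (one_sub_mul_cos_pos ha φ).ne'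
    have hw := (one_add_sq_sub_pos ha φ).ne'
    have h₁ : HasDerivAt (fun φ : ℝ => 1 - a * cos φ) (a * sin φ) φ := by
      simpa using ((hasDerivAt_cos φ).const_mul a).const_sub 1
    have h₂ := ((((hasDerivAt_sin φ).const_mul a).div h₁ hd).arctan.const_mul 2).add
      (hasDerivAt_id φ)
    refine h₂.congr_deriv ?_
    have hs : 1 + (a * sin φ / (1 - a * cos φ)) ^ 2 =
        (1 + a ^ 2 - 2 * a * cos φ) / (1 - a * cos φ) ^ 2 := by
      field_simp
      linear_combination a ^ 2 * sin_sq_add_cos_sq φ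
    rw [Pi.div_apply, hs]
    simp only [Int.cast_zero, zero_mul, cos_zero, zpow_neg_one]
    field_simp
    linear_combination (-2 * a ^ 2) * sin_sq_add_cos_sq φ
  have h := integral_eq_sub_of_hasDerivAt (fun φ _ => hderiv φ)
    ((intervalIntegrable_cosMoment ha (-1) 0).const_mul (1 - a ^ 2))
  rw [integral_const_mul] at h
  simpa [cosMoment] using h

/-- Euler's reflection between the moments of order `n` and of order `-(n + 1)`. -/
lemma cosMoment_reflection {a : ℝ} (ha : |a| < 1) (n i : ℕ) :
    ((n + i).choose i : ℝ) * cosMoment a n i =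
      (-1) ^ i * (n.choose i : ℝ) * (1 - a ^ 2) ^ (2 * n + 1) * cosMoment a (-(n + 1)) i := by
  induction n generalizing i with
  | zero =>
    cases i with
    | zero =>
      have h := cosMoment_neg_one_zero ha
      simp only [Nat.cast_zero, Nat.choose_self, add_zero, zero_add, Nat.cast_one, one_mul,
        pow_zero, mul_zero, pow_one, h]
      simp [cosMoment]
    | succ j => simp [cosMoment_zero_of_ne_zero a (show (j + 1 : ℤ) ≠ 0 by positivity)]
  | succ n ih =>
    have hraise := cosMoment_raise ha n i
    have hlower := cosMoment_lower ha (-(n + 1 + 1)) i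
    rw [show (-(n + 1 + 1) + 1 : ℤ) = -(n + 1) by ring] at hlower
    push_cast at hraise hlower ⊢
    cases i with
    | zero =>
      have h₀ := ih 0
      have h₁ := ih 1
      rw [show ((0 : ℕ) - 1 : ℤ) = -1 by simp] at hraise hlower
      simp only [cosMoment_neg] at hraise hlower
      simp only [Nat.choose_zero_right, Nat.choose_one_right] at h₀ h₁ ⊢
      push_cast at h₀ h₁ hraise hlower ⊢
      refine mul_left_cancel₀ (Nat.cast_add_one_ne_zero n : (n + 1 : ℝ) ≠ 0) ?_
      linear_combination hraise + (n + 1) * (1 + a ^ 2) * h₀ - 2 * a * h₁ +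
        (1 - a ^ 2) ^ (2 * n + 1) * hlower
    | succ j =>
      have h₀ := ih j
      have h₁ := ih (j + 1)
      rw [show ((j + 1 : ℕ) - 1 : ℤ) = j by simp] at hraise hlower
      have c₁ : ((n + 1 + (j + 1)).choose (j + 1) : ℝ) * (n + 1) =
          (n + (j + 1)).choose (j + 1) * (n + 1 + (j + 1)) := by
        have h := Nat.choose_mul_succ_eq (n + (j + 1)) (j + 1)
        rw [show n + (j + 1) + 1 - (j + 1) = n + 1 by omega,
          show n + (j + 1) + 1 = n + 1 + (j + 1) by ring] at h
        exact_mod_cast h.symm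
      have c₂ : ((n + (j + 1)).choose (j + 1) : ℝ) * (j + 1) = (n + j).choose j * (n + j + 1) := by
        have h := Nat.add_one_mul_choose_eq (n + j) j
        rw [mul_comm, add_assoc n j 1] at h
        exact_mod_cast h.symm
      have c₃ : ((n + 1).choose (j + 1) : ℝ) * (j + 1) = (n + 1) * n.choose j := by
        exact_mod_cast (Nat.add_one_mul_choose_eq n j).symm
      have c₄ : (n.choose (j + 1) : ℝ) * (j + 1) = n.choose j * (n - j) := by
        have h : ((n + 1).choose (j + 1) : ℝ) = n.choose j + n.choose (j + 1) := by
          exact_mod_cast Nat.choose_succ_succ n j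
        linear_combination c₃ - (j + 1) * h
      push_cast at h₀ h₁ c₁ hraise hlower ⊢
      have hne : (j + 1 : ℝ) * (n + j + 2) ≠ 0 := by positivity
      refine mul_left_cancel₀ hne ?_
      linear_combination (j + 1) * ((n + 1 + (j + 1)).choose (j + 1) : ℝ) * hraise +
        (1 + a ^ 2) * (j + 1) * cosMoment a n (j + 1) * c₁ -
        2 * a * cosMoment a n j * ((j + 1) * c₁ + (n + j + 2) * c₂) +
        (n + j + 2) * ((1 + a ^ 2) * (j + 1) * h₁ - 2 * a * (n + j + 1) * h₀) +
        (n + j + 2) * (-1) ^ j * (1 - a ^ 2) ^ (2 * n + 1) *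
          (-(1 + a ^ 2) * cosMoment a (-(n + 1)) (j + 1) * c₄ - n.choose j * hlower +
            (1 - a ^ 2) ^ 2 * cosMoment a (-(n + 1 + 1)) (j + 1) * c₃)

theorem euler_functional_equation (a : ℝ) (ha : |a| < 1) (n i : ℕ) :
    ((n + i).choose i : ℝ) * (1 - a ^ 2) ^ (-(n : ℤ)) *
        ∫ φ in (0:ℝ)..Real.pi,
          (1 + a ^ 2 - 2 * a * Real.cos φ) ^ n * Real.cos (i * φ) =
      (-1 : ℝ) ^ i * (n.choose i : ℝ) * (1 - a ^ 2) ^ (n + 1) *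
        ∫ φ in (0:ℝ)..Real.pi,
          Real.cos (i * φ) / (1 + a ^ 2 - 2 * a * Real.cos φ) ^ (n + 1) := by
  have h := cosMoment_reflection ha n i
  have hpos : (1 - a ^ 2) ≠ 0 := by
    have := (sq_lt_one_iff_abs_lt_one a).mpr ha
    linarith
  have hI : cosMoment a n i = ∫ φ in (0:ℝ)..Real.pi,
      (1 + a ^ 2 - 2 * a * Real.cos φ) ^ n * Real.cos (i * φ) := by
    simp [cosMoment]
  have hJ : cosMoment a (-(n + 1)) i = ∫ φ in (0:ℝ)..Real.pi,
      Real.cos (i * φ) / (1 + a ^ 2 - 2 * a * Real.cos φ) ^ (n + 1) := by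
    refine integral_congr fun φ _ => ?_
    rw [zpow_neg, show (n + 1 : ℤ) = (n + 1 : ℕ) by simp, zpow_natCast, Int.cast_natCast,
      div_eq_inv_mul]
  rw [← hI, ← hJ, zpow_neg, zpow_natCast]
  field_simp
  linear_combination h
end

section
/- Let a be a real number with |a| < 1 and let n, i be natural numbers with i ≤ n. Then ∫₀^π cos(iφ)/(1 + a² − 2a·cos φ)^{n+1} dφ = (π·a^i/(1−a²)^{2n+1}) · ∑_{k=0}^{n−i} C(n+i, i+k)·C(n−i, k)·a^{2k}, where C(·,·) denotes the binomial coefficient. -/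
open intervalIntegral Real Finset

/-- The disk automorphism `z ↦ (z - a) / (1 - a z)` for a real parameter `a`. -/
noncomputable def diskShift (a : ℝ) (z : ℂ) : ℂ := (z - a) / (1 - a * z)

lemma one_sub_mul_ne_zero_of_abs_lt_one {a : ℝ} (ha : |a| < 1) {z : ℂ} (hz : ‖z‖ ≤ 1) :
    1 - (a : ℂ) * z ≠ 0 := by
  intro h
  have h1 : ‖(a : ℂ) * z‖ = 1 := by rw [← sub_eq_zero.1 h, norm_one]
  rw [norm_mul, Complex.norm_real, Real.norm_eq_abs] at h1
  nlinarith [abs_nonneg a, norm_nonneg z]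

lemma sub_ne_zero_of_abs_lt_one {a : ℝ} (ha : |a| < 1) {z : ℂ} (hz : ‖z‖ = 1) :
    z - (a : ℂ) ≠ 0 := by
  intro h
  rw [sub_eq_zero.1 h, Complex.norm_real, Real.norm_eq_abs] at hz
  linarith

lemma diskShift_ne_zero {a : ℝ} (ha : |a| < 1) {z : ℂ} (hz : ‖z‖ = 1) : diskShift a z ≠ 0 :=
  div_ne_zero (sub_ne_zero_of_abs_lt_one ha hz) (one_sub_mul_ne_zero_of_abs_lt_one ha hz.le)

lemma one_sub_sq_ne_zero_of_abs_lt_one {a : ℝ} (ha : |a| < 1) : 1 - (a : ℂ) ^ 2 ≠ 0 := by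
  have h : (a : ℝ) ^ 2 < 1 := (sq_lt_one_iff_abs_lt_one a).2 ha
  exact_mod_cast (sub_pos.2 h).ne'

lemma diskShift_inv {a : ℝ} {z : ℂ} (hz : z ≠ 0) : diskShift a z⁻¹ = (diskShift a z)⁻¹ := by
  have h1 : z⁻¹ - a = (1 - a * z) / z := by field_simp
  have h2 : 1 - a * z⁻¹ = (z - a) / z := by field_simp
  rw [diskShift, diskShift, h1, h2, inv_div, div_div_div_cancel_right₀ hz]

lemma poissonKernel_ofReal_of_norm_eq_one {a : ℝ} {z : ℂ} (hz : ‖z‖ = 1) :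
    (poissonKernel 0 a z : ℂ) = (1 - (a : ℂ) ^ 2) / ((1 - a * z) * (1 - a * z⁻¹)) := by
  have hz0 : z ≠ 0 := norm_ne_zero_iff.1 (by simp [hz])
  have hconj : (starRingEnd ℂ) z = z⁻¹ := by
    rw [Complex.inv_def, Complex.normSq_eq_norm_sq, hz]; simp
  have h : ((‖z - a‖ ^ 2 : ℝ) : ℂ) = (1 - a * z) * (1 - a * z⁻¹) := by
    rw [← Complex.normSq_eq_norm_sq, ← Complex.mul_conj, map_sub, hconj, Complex.conj_ofReal]
    field_simp
  rw [poissonKernel_def, Complex.ofReal_div]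
  simp only [sub_zero]
  rw [h, hz]
  simp

lemma circleAverage_poissonKernel_smul_diskShift_pow {a : ℝ} (ha : |a| < 1) (m : ℕ) :
    circleAverage (fun z ↦ poissonKernel 0 a z • diskShift a z ^ m) 0 1 =
      if m = 0 then 1 else 0 := by
  have hd : DifferentiableOn ℂ (fun z ↦ diskShift a z ^ m) (Metric.closedBall 0 1) := by
    intro z hz
    have := one_sub_mul_ne_zero_of_abs_lt_one ha (mem_closedBall_zero_iff.1 hz)
    have hdiff : DifferentiableAt ℂ (fun z : ℂ ↦ (z - a) / (1 - a * z)) z :=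
      DifferentiableAt.div (by fun_prop) (by fun_prop) this
    exact (hdiff.pow m).differentiableWithinAt
  have hd' : DiffContOnCl ℂ (fun z ↦ diskShift a z ^ m) (Metric.ball 0 1) :=
    DifferentiableOn.diffContOnCl_ball (U := Metric.closedBall 0 1) hd subset_rfl
  have := hd'.circleAverage_poissonKernel_smul (w := (a : ℂ)) (by simpa using ha)
  refine this.trans ?_
  simp [diskShift, zero_pow_eq]

lemma circleAverage_poissonKernel_smul_diskShift_zpow {a : ℝ} (ha : |a| < 1) (m : ℤ) :
    circleAverage (fun z ↦ poissonKernel 0 a z • diskShift a z ^ m) 0 1 =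
      if m = 0 then 1 else 0 := by
  obtain ⟨k, rfl | rfl⟩ := m.eq_nat_or_neg
  · simpa using circleAverage_poissonKernel_smul_diskShift_pow ha k
  · rw [← circleAverage_zero_one_congr_inv]
    have := circleAverage_poissonKernel_smul_diskShift_pow ha k
    simp only [neg_eq_zero, Nat.cast_eq_zero]
    rw [← this]
    refine circleAverage_congr_sphere fun z hz ↦ ?_
    have hz1 : ‖z‖ = 1 := by simpa using hz
    have hz0 : z ≠ 0 := norm_ne_zero_iff.1 (by simp [hz1])
    simp only [Complex.real_smul]
    rw [poissonKernel_ofReal_of_norm_eq_one hz1,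
      poissonKernel_ofReal_of_norm_eq_one (by rw [norm_inv, hz1, inv_one]),
      diskShift_inv hz0, inv_inv, zpow_neg, inv_zpow, inv_inv, zpow_natCast,
      mul_comm (1 - a * z)]

lemma pow_div_pow_eq_sum_poissonKernel_mul_diskShift_zpow {a : ℝ} (ha : |a| < 1) {n i : ℕ}
    (hi : i ≤ n) {z : ℂ} (hz : ‖z‖ = 1) :
    z ^ i / ((1 - a * z) * (1 - a * z⁻¹)) ^ (n + 1) =
      ∑ k ∈ range (n - i + 1), ∑ j ∈ range (n + i + 1),
        ((n + i).choose j * (n - i).choose k * (a : ℂ) ^ (j + k) /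
            (1 - (a : ℂ) ^ 2) ^ (2 * n + 1)) *
          (poissonKernel 0 a z • diskShift a z ^ ((i : ℤ) + k - j)) := by
  have hz0 : z ≠ 0 := norm_ne_zero_iff.1 (by simp [hz])
  have h1 := one_sub_mul_ne_zero_of_abs_lt_one ha hz.le
  have h2 := sub_ne_zero_of_abs_lt_one ha hz
  have h3 := one_sub_sq_ne_zero_of_abs_lt_one ha
  have hw := diskShift_ne_zero ha hz
  have e1 : a * diskShift a z + 1 = (1 - (a : ℂ) ^ 2) / (1 - a * z) := by
    rw [diskShift]; field_simp; ring
  have e2 : a * (diskShift a z)⁻¹ + 1 = (1 - (a : ℂ) ^ 2) * z / (z - a) := by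
    rw [diskShift]; field_simp; ring
  have e3 : 1 - a * z⁻¹ = (z - a) / z := by field_simp
  have key : diskShift a z ^ i * (a * diskShift a z + 1) ^ (n - i) *
      (a * (diskShift a z)⁻¹ + 1) ^ (n + i) =
      (1 - (a : ℂ) ^ 2) ^ (2 * n) * (z ^ i / ((1 - a * z) * (1 - a * z⁻¹)) ^ n) := by
    rw [e1, e2, e3, diskShift]
    obtain ⟨d, rfl⟩ := Nat.exists_eq_add_of_le hi
    rw [Nat.add_sub_cancel_left]
    simp only [div_pow, mul_pow]
    field_simp
    ring
  have expand : diskShift a z ^ i * (a * diskShift a z + 1) ^ (n - i) *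
      (a * (diskShift a z)⁻¹ + 1) ^ (n + i) =
      ∑ k ∈ range (n - i + 1), ∑ j ∈ range (n + i + 1),
        (n + i).choose j * (n - i).choose k * (a : ℂ) ^ (j + k) *
          diskShift a z ^ ((i : ℤ) + k - j) := by
    rw [add_pow, add_pow, mul_assoc, sum_mul_sum, mul_sum]
    refine sum_congr rfl fun k _ ↦ ?_
    rw [mul_sum]
    refine sum_congr rfl fun j _ ↦ ?_
    rw [zpow_sub₀ hw, zpow_add₀ hw]
    simp only [zpow_natCast, mul_pow, one_pow, inv_pow]
    field_simp
    ring
  have step : z ^ i / ((1 - a * z) * (1 - a * z⁻¹)) ^ (n + 1) =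
      poissonKernel 0 a z / (1 - (a : ℂ) ^ 2) ^ (2 * n + 1) *
        ((1 - (a : ℂ) ^ 2) ^ (2 * n) * (z ^ i / ((1 - a * z) * (1 - a * z⁻¹)) ^ n)) := by
    rw [poissonKernel_ofReal_of_norm_eq_one hz, e3, pow_succ]
    field_simp
    ring
  rw [step, ← key, expand, mul_sum]
  refine sum_congr rfl fun k _ ↦ ?_
  rw [mul_sum]
  refine sum_congr rfl fun j _ ↦ ?_
  rw [Complex.real_smul]
  ring

lemma circleIntegrable_poissonKernel_smul_diskShift_zpow {a : ℝ} (ha : |a| < 1) (m : ℤ) :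
    CircleIntegrable (fun z ↦ poissonKernel 0 a z • diskShift a z ^ m) 0 1 := by
  refine ContinuousOn.circleIntegrable zero_le_one fun z hz ↦ ContinuousAt.continuousWithinAt ?_
  have hz : ‖z‖ = 1 := by simpa using hz
  have h1 := one_sub_mul_ne_zero_of_abs_lt_one ha hz.le
  have h2 := sub_ne_zero_of_abs_lt_one ha hz
  have hw := diskShift_ne_zero ha hz
  refine ContinuousAt.smul (f := poissonKernel 0 a) ?_
    (ContinuousAt.zpow₀ (f := diskShift a) ?_ m (Or.inl hw))
  · unfold poissonKernel
    refine ContinuousAt.div (by fun_prop) (by fun_prop) ?_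
    simpa using h2
  · unfold diskShift
    exact ContinuousAt.div (by fun_prop) (by fun_prop) h1

lemma circleAverage_pow_div_pow {a : ℝ} (ha : |a| < 1) {n i : ℕ} (hi : i ≤ n) :
    circleAverage (fun z : ℂ ↦ z ^ i / ((1 - a * z) * (1 - a * z⁻¹)) ^ (n + 1)) 0 1 =
      (a : ℂ) ^ i / (1 - (a : ℂ) ^ 2) ^ (2 * n + 1) *
        ∑ k ∈ range (n - i + 1),
          ((n + i).choose (i + k) : ℂ) * ((n - i).choose k : ℂ) * (a : ℂ) ^ (2 * k) := by
  rw [circleAverage_congr_sphere fun z hz ↦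
    pow_div_pow_eq_sum_poissonKernel_mul_diskShift_zpow ha hi (z := z) (by simpa using hz)]
  have hci (c : ℂ) (m : ℤ) :
      CircleIntegrable (fun z ↦ c * (poissonKernel 0 a z • diskShift a z ^ m)) 0 1 :=
    (circleIntegrable_poissonKernel_smul_diskShift_zpow ha m).const_smul (a := c)
  rw [circleAverage_fun_sum fun k _ ↦ CircleIntegrable.fun_sum _ fun j _ ↦ hci _ _, mul_sum]
  refine sum_congr rfl fun k hk ↦ ?_
  rw [circleAverage_fun_sum fun j _ ↦ hci _ _]
  have hc (c : ℂ) (m : ℤ) :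
      circleAverage (fun z ↦ c * (poissonKernel 0 a z • diskShift a z ^ m)) 0 1 =
        c * if m = 0 then 1 else 0 := by
    rw [← circleAverage_poissonKernel_smul_diskShift_zpow ha m]
    exact circleAverage_fun_smul (a := c)
  simp only [hc]
  rw [sum_eq_single (i + k)]
  · rw [if_pos (by push_cast; ring)]
    ring
  · intro j _ hj
    rw [if_neg (by omega), mul_zero]
  · intro h
    simp only [mem_range] at h hk
    omega

lemma integral_cos_div_pow_eq_pi_mul_circleAverage {a : ℝ} (ha : |a| < 1) (n i : ℕ) :
    ((∫ φ in (0 : ℝ)..π, cos (i * φ) / (1 + a ^ 2 - 2 * a * cos φ) ^ (n + 1) : ℝ) : ℂ) =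
      π * circleAverage (fun z : ℂ ↦ z ^ i / ((1 - a * z) * (1 - a * z⁻¹)) ^ (n + 1)) 0 1 := by
  set F : ℝ → ℂ := fun φ ↦
    Complex.exp (i * φ * Complex.I) / ((1 + a ^ 2 - 2 * a * cos φ : ℝ) : ℂ) ^ (n + 1) with hF
  have hpos (φ : ℝ) : 1 + a ^ 2 - 2 * a * cos φ ≠ 0 := by
    have h1 := (abs_lt.1 ha).1
    have h2 := (abs_lt.1 ha).2
    rcases le_total 0 a with h | h
    · nlinarith [mul_nonneg h (sub_nonneg.2 (cos_le_one φ)), mul_self_pos.2 (sub_pos.2 h2).ne']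
    · nlinarith [mul_nonneg (neg_nonneg.2 h) (neg_le_iff_add_nonneg'.1 (neg_one_le_cos φ)),
        mul_self_pos.2 (neg_lt_iff_pos_add'.1 h1).ne']
  have hcont : Continuous F :=
    Continuous.div (by fun_prop) (by fun_prop) fun φ ↦
      pow_ne_zero _ (Complex.ofReal_ne_zero.2 (hpos φ))
  have hcircle (φ : ℝ) : (circleMap 0 1 φ) ^ i /
      ((1 - a * circleMap 0 1 φ) * (1 - a * (circleMap 0 1 φ)⁻¹)) ^ (n + 1) = F φ := by
    have hm : circleMap 0 1 φ = Complex.exp (φ * Complex.I) := by simp [circleMap]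
    rw [hm, ← Complex.exp_nat_mul, ← Complex.exp_neg, hF]
    have hprod : Complex.exp (φ * Complex.I) * Complex.exp (-(φ * Complex.I)) = 1 := by
      rw [← Complex.exp_add, add_neg_cancel, Complex.exp_zero]
    have hcos : 2 * Complex.cos φ =
        Complex.exp (φ * Complex.I) + Complex.exp (-(φ * Complex.I)) := by
      rw [Complex.two_cos, neg_mul]
    simp only [mul_assoc]
    congr 2
    push_cast
    linear_combination (a : ℂ) ^ 2 * hprod + (a : ℂ) * hcos
  have hreflect (φ : ℝ) : F φ + F (2 * π - φ) =
      2 * ((cos (i * φ) / (1 + a ^ 2 - 2 * a * cos φ) ^ (n + 1) : ℝ) : ℂ) := by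
    have he : Complex.exp (i * ((2 * π - φ : ℝ) : ℂ) * Complex.I) =
        Complex.exp (-(i * φ) * Complex.I) := by
      rw [Complex.exp_eq_exp_iff_exists_int]
      exact ⟨i, by push_cast; ring⟩
    simp only [hF]
    rw [he, cos_two_pi_sub, ← add_div, ← Complex.two_cos]
    push_cast
    ring
  have hI (x y : ℝ) : IntervalIntegrable F MeasureTheory.volume x y := hcont.intervalIntegrable x y
  have hsplit : ∫ φ in (0 : ℝ)..2 * π, F φ = ∫ φ in (0 : ℝ)..π, (F φ + F (2 * π - φ)) := by
    rw [integral_add (hI _ _)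
        ((by fun_prop : Continuous fun φ ↦ F (2 * π - φ)).intervalIntegrable _ _),
      integral_comp_sub_left, ← integral_add_adjacent_intervals (hI 0 π) (hI π (2 * π))]
    congr 2 <;> ring
  rw [circleAverage_def]
  simp only [hcircle, hsplit, hreflect]
  rw [intervalIntegral.integral_const_mul, intervalIntegral.integral_ofReal, Complex.real_smul]
  have hπ : (π : ℂ) ≠ 0 := Complex.ofReal_ne_zero.2 pi_ne_zero
  push_cast
  field_simp

theorem euler_explicit_formula (a : ℝ) (ha : |a| < 1) (n i : ℕ) (hi : i ≤ n) :
    (∫ φ in (0:ℝ)..Real.pi,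
        Real.cos (i * φ) / (1 + a ^ 2 - 2 * a * Real.cos φ) ^ (n + 1)) =
      Real.pi * a ^ i / (1 - a ^ 2) ^ (2 * n + 1) *
        ∑ k ∈ Finset.range (n - i + 1),
          ((n + i).choose (i + k) : ℝ) * ((n - i).choose k : ℝ) * a ^ (2 * k) := by
  apply Complex.ofReal_injective
  rw [integral_cos_div_pow_eq_pi_mul_circleAverage ha, circleAverage_pow_div_pow ha hi]
  push_cast
  ring
end

section
/- For every real number t > 1 and every natural number n, ∫₀^π (t + √(t²−1)·cos φ)ⁿ dφ = ∫₀^π (t + √(t²−1)·cos φ)^{−n−1} dφ. -/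
open intervalIntegral Real

/-- If `t ^ 2 - s ^ 2 = 1` and `0 < t + s * cos φ`, the Möbius image
`-(s + t * cos φ) / (t + s * cos φ)` of `cos φ` satisfies the analogue of `1 - cos ^ 2 = sin ^ 2`. -/
lemma one_sub_mobius_cos_sq {t s φ : ℝ} (hts : t ^ 2 - s ^ 2 = 1) (hD : 0 < t + s * cos φ) :
    1 - (-(s + t * cos φ) / (t + s * cos φ)) ^ 2 = (sin φ / (t + s * cos φ)) ^ 2 := by
  field_simp
  rw [sin_sq]
  linear_combination (1 - cos φ ^ 2) * hts

lemma add_mul_mobius_cos {t s φ : ℝ} (hts : t ^ 2 - s ^ 2 = 1) (hD : 0 < t + s * cos φ) :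
    t + s * (-(s + t * cos φ) / (t + s * cos φ)) = (t + s * cos φ)⁻¹ := by
  field_simp
  linear_combination hts

lemma cos_arccos_mobius_cos {t s φ : ℝ} (hts : t ^ 2 - s ^ 2 = 1) (hD : 0 < t + s * cos φ) :
    cos (arccos (-(s + t * cos φ) / (t + s * cos φ))) = -(s + t * cos φ) / (t + s * cos φ) := by
  have h := one_sub_mobius_cos_sq hts hD
  have h1 := sq_nonneg (sin φ / (t + s * cos φ))
  have h2 := abs_le.1 (abs_le_one_iff_mul_self_le_one.2
    (show -(s + t * cos φ) / (t + s * cos φ) * (-(s + t * cos φ) / (t + s * cos φ)) ≤ 1 by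
      nlinarith))
  exact cos_arccos h2.1 h2.2

lemma hasDerivAt_arccos_mobius_cos {t s φ : ℝ} (hts : t ^ 2 - s ^ 2 = 1)
    (hD : 0 < t + s * cos φ) (hsin : 0 < sin φ) :
    HasDerivAt (fun x => arccos (-(s + t * cos x) / (t + s * cos x)))
      (-(t + s * cos φ)⁻¹) φ := by
  have h := one_sub_mobius_cos_sq hts hD
  have hpos : 0 < sin φ / (t + s * cos φ) := div_pos hsin hD
  have hu : HasDerivAt (fun x => -(s + t * cos x) / (t + s * cos x))
      (sin φ / (t + s * cos φ) ^ 2) φ := by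
    have hnum := (((hasDerivAt_cos φ).const_mul t).const_add s).fun_neg
    have hden := ((hasDerivAt_cos φ).const_mul s).const_add t
    refine (hnum.fun_div hden hD.ne').congr_deriv (congrArg (· / (t + s * cos φ) ^ 2) ?_)
    linear_combination sin φ * hts
  have hne1 : -(s + t * cos φ) / (t + s * cos φ) ≠ -1 := fun h' => by
    rw [h'] at h
    nlinarith [pow_pos hpos 2]
  have hne2 : -(s + t * cos φ) / (t + s * cos φ) ≠ 1 := fun h' => by
    rw [h'] at h
    nlinarith [pow_pos hpos 2]
  refine ((hasDerivAt_arccos hne1 hne2).comp φ hu).congr_deriv ?_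
  rw [h, sqrt_sq hpos.le]
  field_simp

theorem euler_jacobi_integral_relation (t : ℝ) (ht : 1 < t) (n : ℕ) :
    (∫ φ in (0:ℝ)..Real.pi, (t + Real.sqrt (t ^ 2 - 1) * Real.cos φ) ^ n) =
      ∫ φ in (0:ℝ)..Real.pi,
        (t + Real.sqrt (t ^ 2 - 1) * Real.cos φ) ^ (-(n : ℤ) - 1) := by
  have hsq : √(t ^ 2 - 1) ^ 2 = t ^ 2 - 1 := sq_sqrt (by nlinarith)
  have hs0 := sqrt_nonneg (t ^ 2 - 1)
  generalize √(t ^ 2 - 1) = s at hsq hs0 ⊢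
  have hts : t ^ 2 - s ^ 2 = 1 := by linarith
  have hst : s < t := by nlinarith
  have hD : ∀ φ, 0 < t + s * cos φ := fun φ => by nlinarith [neg_one_le_cos φ]
  have hcont : Continuous fun φ => t + s * cos φ := by fun_prop
  have key := integral_comp_mul_deriv'' (a := 0) (b := π)
    (f := fun x => arccos (-(s + t * cos x) / (t + s * cos x)))
    (f' := fun x => -(t + s * cos x)⁻¹) (g := fun x => (t + s * cos x) ^ n)
    (continuous_arccos.comp
      (Continuous.div (by fun_prop) hcont fun x => (hD x).ne')).continuousOn
    (fun x hx => by
      rw [min_eq_left pi_pos.le, max_eq_right pi_pos.le] at hx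
      exact (hasDerivAt_arccos_mobius_cos hts (hD x) (sin_pos_of_mem_Ioo hx)).hasDerivWithinAt)
    (hcont.inv₀ fun x => (hD x).ne').neg.continuousOn
    (hcont.pow n).continuousOn
  have h0 : -(s + t * cos 0) / (t + s * cos 0) = -1 := by
    rw [div_eq_iff (hD 0).ne', cos_zero]
    ring
  have hpi : -(s + t * cos π) / (t + s * cos π) = 1 := by
    rw [div_eq_iff (hD π).ne', cos_pi]
    ring
  simp only [h0, hpi, arccos_neg_one, arccos_one] at key
  rw [integral_symm π 0, ← key, ← integral_neg]
  refine integral_congr fun x _ => ?_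
  have hx := (hD x).ne'
  simp only [Function.comp_apply]
  rw [cos_arccos_mobius_cos hts (hD x), add_mul_mobius_cos hts (hD x), zpow_sub_one₀ hx,
    zpow_neg, zpow_natCast, inv_pow]
  ring
end

section
/- For every real number t > 1 and every natural number n, Pₙ(t) = (1/π)·∫₀^π (t + √(t²−1)·cos φ)^{−n−1} dφ. -/
open Real intervalIntegral

lemma add_sqrt_mul_cos_pos {t : ℝ} (ht : 1 < t) (φ : ℝ) : 0 < t + √(t ^ 2 - 1) * cos φ := by
  have hs : √(t ^ 2 - 1) < t := by
    rw [Real.sqrt_lt' (by linarith)]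
    linarith
  nlinarith [neg_one_le_cos φ, Real.sqrt_nonneg (t ^ 2 - 1)]

lemma intervalIntegrable_inv_add_sqrt_mul_cos_pow {t : ℝ} (ht : 1 < t) (m : ℕ) (a b : ℝ) :
    IntervalIntegrable (fun φ => ((t + √(t ^ 2 - 1) * cos φ)⁻¹) ^ m) MeasureTheory.volume a b := by
  refine Continuous.intervalIntegrable ?_ _ _
  exact (Continuous.inv₀ (by fun_prop) fun φ => (add_sqrt_mul_cos_pos ht φ).ne').pow m

lemma hasDerivAt_add_sqrt_mul_cos (t φ : ℝ) :
    HasDerivAt (fun φ => t + √(t ^ 2 - 1) * cos φ) (√(t ^ 2 - 1) * -sin φ) φ :=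
  ((hasDerivAt_cos φ).const_mul _).const_add t

/-- The kernel `1 / (t + √(t² - 1) cos φ)` has the antiderivative
`φ - 2 arctan (√(t² - 1) sin φ / (t + 1 + √(t² - 1) cos φ))`. -/
lemma integral_inv_add_sqrt_mul_cos {t : ℝ} (ht : 1 < t) :
    ∫ φ in (0 : ℝ)..π, (t + √(t ^ 2 - 1) * cos φ)⁻¹ = π := by
  have hs : √(t ^ 2 - 1) ^ 2 = t ^ 2 - 1 := Real.sq_sqrt (by nlinarith)
  have hd (φ : ℝ) : HasDerivAt
      (fun φ => φ - 2 * arctan (√(t ^ 2 - 1) * sin φ / (1 + (t + √(t ^ 2 - 1) * cos φ))))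
      ((t + √(t ^ 2 - 1) * cos φ)⁻¹) φ := by
    have hu := add_sqrt_mul_cos_pos ht φ
    have hD : 1 + (t + √(t ^ 2 - 1) * cos φ) ≠ 0 := by positivity
    have h := (hasDerivAt_id φ).sub (((((hasDerivAt_sin φ).const_mul √(t ^ 2 - 1)).div
      ((hasDerivAt_add_sqrt_mul_cos t φ).const_add 1) hD).arctan).const_mul 2)
    refine h.congr_deriv ?_
    have hsc := sin_sq_add_cos_sq φ
    simp only [Pi.div_apply]
    generalize √(t ^ 2 - 1) = s at *
    generalize cos φ = c at *
    generalize sin φ = d at *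
    have hden : (1 + (t + s * c)) ^ 2 + (s * d) ^ 2 = 2 * (t + 1) * (t + s * c) := by
      linear_combination s ^ 2 * hsc + hs
    have hnum : s * c * (1 + (t + s * c)) - s * d * (s * -d) = (t + 1) * (t + s * c - 1) := by
      linear_combination s ^ 2 * hsc + hs
    have ht1 : t + 1 ≠ 0 := by linarith
    have hone : 1 + (s * d / (1 + (t + s * c))) ^ 2
        = 2 * (t + 1) * (t + s * c) / (1 + (t + s * c)) ^ 2 := by
      rw [← hden]
      field_simp
    rw [hone, hnum]
    field_simp
    ring
  have hint := intervalIntegrable_inv_add_sqrt_mul_cos_pow ht 1 0 π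
  simp only [pow_one] at hint
  rw [integral_eq_sub_of_hasDerivAt (fun φ _ => hd φ) hint]
  simp

/-- The three-term recurrence satisfied by the integrals of the negative powers of
`t + √(t² - 1) cos φ`, obtained by integrating the derivative of
`sin φ / (t + √(t² - 1) cos φ) ^ (m + 1)`. -/
lemma integral_inv_add_sqrt_mul_cos_pow_recurrence {t : ℝ} (ht : 1 < t) (m : ℕ) :
    (m + 1) * ∫ φ in (0 : ℝ)..π, ((t + √(t ^ 2 - 1) * cos φ)⁻¹) ^ (m + 2) =
      (2 * m + 1) * t * (∫ φ in (0 : ℝ)..π, ((t + √(t ^ 2 - 1) * cos φ)⁻¹) ^ (m + 1)) -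
        m * ∫ φ in (0 : ℝ)..π, ((t + √(t ^ 2 - 1) * cos φ)⁻¹) ^ m := by
  have hs : √(t ^ 2 - 1) ^ 2 = t ^ 2 - 1 := Real.sq_sqrt (by nlinarith)
  have hd (φ : ℝ) : HasDerivAt
      (fun φ => √(t ^ 2 - 1) * (sin φ * ((t + √(t ^ 2 - 1) * cos φ)⁻¹) ^ (m + 1)))
      ((2 * m + 1) * t * ((t + √(t ^ 2 - 1) * cos φ)⁻¹) ^ (m + 1) -
        m * ((t + √(t ^ 2 - 1) * cos φ)⁻¹) ^ m -
        (m + 1) * ((t + √(t ^ 2 - 1) * cos φ)⁻¹) ^ (m + 2)) φ := by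
    have hu := (add_sqrt_mul_cos_pos ht φ).ne'
    have h := ((hasDerivAt_sin φ).mul
      (((hasDerivAt_add_sqrt_mul_cos t φ).inv hu).pow (m + 1))).const_mul √(t ^ 2 - 1)
    refine h.congr_deriv ?_
    have hsc := sin_sq_add_cos_sq φ
    simp only [Pi.inv_apply, Pi.pow_apply, Nat.add_sub_cancel]
    generalize √(t ^ 2 - 1) = s at *
    generalize cos φ = c at *
    generalize sin φ = d at *
    have huv := inv_mul_cancel₀ hu
    rw [div_eq_mul_inv, ← inv_pow]
    generalize (t + s * c)⁻¹ = v at *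
    push_cast
    linear_combination v ^ m * ((m + 1) * v ^ 2 * (s ^ 2 * hsc + hs) +
      ((m + 1) * v * (t - s * c) - m) * huv)
  have hi (k : ℕ) := intervalIntegrable_inv_add_sqrt_mul_cos_pow ht k 0 π
  have h := integral_eq_sub_of_hasDerivAt (fun φ _ => hd φ)
    ((((hi (m + 1)).const_mul _).sub ((hi m).const_mul _)).sub ((hi (m + 2)).const_mul _))
  rw [integral_sub (((hi (m + 1)).const_mul _).sub ((hi m).const_mul _)) ((hi (m + 2)).const_mul _),
    integral_sub ((hi (m + 1)).const_mul _) ((hi m).const_mul _)] at h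
  simp only [integral_const_mul, sin_pi, sin_zero, zero_mul, mul_zero, sub_zero] at h
  linarith

lemma pi_mul_legendreP {t : ℝ} (ht : 1 < t) (n : ℕ) :
    π * legendreP n t = ∫ φ in (0 : ℝ)..π, ((t + √(t ^ 2 - 1) * cos φ)⁻¹) ^ (n + 1) := by
  induction n using Nat.twoStepInduction with
  | zero => simp [legendreP, integral_inv_add_sqrt_mul_cos ht]
  | one =>
    have h := integral_inv_add_sqrt_mul_cos_pow_recurrence ht 0
    simp only [Nat.cast_zero, zero_add, mul_zero, one_mul, zero_mul, sub_zero, pow_one,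
      integral_inv_add_sqrt_mul_cos ht] at h
    rw [legendreP, h, mul_comm]
  | more n ih₀ ih₁ =>
    have h := integral_inv_add_sqrt_mul_cos_pow_recurrence ht (n + 1)
    rw [← ih₀, ← ih₁] at h
    push_cast at h
    have hn : (n : ℝ) + 1 + 1 ≠ 0 := by positivity
    rw [legendreP, ← mul_div_assoc, div_eq_iff hn]
    linear_combination -h

theorem legendre_laplace_representation_neg (t : ℝ) (ht : 1 < t) (n : ℕ) :
    legendreP n t =
      (1 / Real.pi) *
        ∫ φ in (0:ℝ)..Real.pi,
          (t + Real.sqrt (t ^ 2 - 1) * Real.cos φ) ^ (-(n : ℤ) - 1) := by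
  have hpow (φ : ℝ) : (t + √(t ^ 2 - 1) * cos φ) ^ (-(n : ℤ) - 1) =
      ((t + √(t ^ 2 - 1) * cos φ)⁻¹) ^ (n + 1) := by
    rw [inv_pow, ← zpow_natCast _ (n + 1), ← zpow_neg]
    congr 1
    push_cast
    ring
  simp only [hpow]
  rw [← pi_mul_legendreP ht, ← mul_assoc, one_div_mul_cancel pi_ne_zero, one_mul]
end

section
/- Let a, b, c be complex numbers such that c is not a nonpositive integer, and let x be a complex number with ‖x‖ < 1. Then ₂F₁(a, b, c; x) = (1−x)^{c−a−b} · ₂F₁(c−a, c−b, c; x), where (1−x)^{c−a−b} is taken with the principal branch of the complex power. -/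
open Complex

/-- The Gaussian hypergeometric series `₂F₁(a, b, c; x)`, defined as
`∑_{k=0}^∞ ((a)_k (b)_k / (c)_k) · xᵏ / k!` where `(q)_k` is the rising factorial. -/
noncomputable def hyp2F1 (a b c x : ℂ) : ℂ :=
  ∑' k : ℕ,
    ((ascPochhammer ℂ k).eval a * (ascPochhammer ℂ k).eval b /
        (ascPochhammer ℂ k).eval c) * x ^ k / (k.factorial : ℂ)

section PowerSeriesIdentity

open PowerSeries

variable {K : Type*} [Field K]

theorem ordinaryHypergeometricCoefficient_succ [CharZero K] (a b c : K)
    (hc : ∀ m : ℕ, c ≠ -(m : K)) (n : ℕ) :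
    (n + 1) * (c + n) * ordinaryHypergeometricCoefficient a b c (n + 1) =
      (a + n) * (b + n) * ordinaryHypergeometricCoefficient a b c n := by
  have hn : (n : K) + 1 ≠ 0 := Nat.cast_add_one_ne_zero n
  have hcn : c + n ≠ 0 := fun h ↦ hc n (eq_neg_of_add_eq_zero_left h)
  simp only [ordinaryHypergeometricCoefficient, ascPochhammer_succ_eval, Nat.factorial_succ,
    Nat.cast_mul, Nat.cast_add, Nat.cast_one, mul_inv]
  field_simp

theorem ordinaryHypergeometricCoefficient_zero (a b c : K) :
    ordinaryHypergeometricCoefficient a b c 0 = 1 := by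
  simp [ordinaryHypergeometricCoefficient]

/-- Left-hand side of the hypergeometric differential equation, for formal power series. -/
noncomputable def hypergeometricOperator (a b c : K) (f : K⟦X⟧) : K⟦X⟧ :=
  X * (1 - X) * d⁄dX K (d⁄dX K f) + (C c - (C a + C b + 1) * X) * d⁄dX K f - C a * C b * f

theorem coeff_hypergeometricOperator (a b c : K) (f : K⟦X⟧) (n : ℕ) :
    coeff n (hypergeometricOperator a b c f) =
      (n + 1) * (c + n) * coeff (n + 1) f - (a + n) * (b + n) * coeff n f := by
  have h : hypergeometricOperator a b c f =
      X * d⁄dX K (d⁄dX K f) - X * (X * d⁄dX K (d⁄dX K f)) + C c * d⁄dX K f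
        - C (a + b + 1) * (X * d⁄dX K f) - C (a * b) * f := by
    simp only [hypergeometricOperator, map_add, map_mul, map_one]
    ring
  rw [h]
  simp only [map_sub, map_add (coeff n), coeff_C_mul]
  rcases n with _ | _ | n
  · simp only [coeff_zero_X_mul, coeff_derivative]
    push_cast
    ring
  · simp only [coeff_zero_X_mul, coeff_succ_X_mul, coeff_derivative]
    push_cast
    ring
  · simp only [coeff_succ_X_mul, coeff_derivative]
    push_cast
    ring

theorem eq_mk_ordinaryHypergeometricCoefficient_iff [CharZero K] (a b c : K)
    (hc : ∀ m : ℕ, c ≠ -(m : K)) (f : K⟦X⟧) :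
    f = mk (ordinaryHypergeometricCoefficient a b c) ↔
      constantCoeff f = 1 ∧ hypergeometricOperator a b c f = 0 := by
  constructor
  · rintro rfl
    refine ⟨by rw [← coeff_zero_eq_constantCoeff_apply, coeff_mk,
      ordinaryHypergeometricCoefficient_zero], ?_⟩
    ext n
    rw [coeff_hypergeometricOperator, coeff_mk, coeff_mk,
      ordinaryHypergeometricCoefficient_succ a b c hc, sub_self, map_zero]
  · rintro ⟨h0, hf⟩
    ext n
    rw [coeff_mk]
    induction n with
    | zero => rw [coeff_zero_eq_constantCoeff_apply, h0, ordinaryHypergeometricCoefficient_zero]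
    | succ n ih =>
      have hcn : c + n ≠ 0 := fun h ↦ hc n (eq_neg_of_add_eq_zero_left h)
      have h := coeff_hypergeometricOperator a b c f n
      rw [hf, map_zero, ih, ← ordinaryHypergeometricCoefficient_succ a b c hc] at h
      exact mul_left_cancel₀ (mul_ne_zero (Nat.cast_add_one_ne_zero n) hcn)
        (sub_eq_zero.mp h.symm)

/-- The first-order equation of the formal power series of `(1 - X) ^ (-s)`. -/
theorem one_sub_X_mul_derivative_mk_ordinaryHypergeometricCoefficient [CharZero K] (s : K) :
    (1 - X) * d⁄dX K (mk (ordinaryHypergeometricCoefficient s 1 1)) =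
      C s * mk (ordinaryHypergeometricCoefficient s 1 1) := by
  have h1 (m : ℕ) : (1 : K) ≠ -(m : K) := fun h ↦
    Nat.cast_add_one_ne_zero m (by linear_combination h : (m : K) + 1 = 0)
  have key (n : ℕ) : (n + 1) * ordinaryHypergeometricCoefficient s 1 1 (n + 1) =
      (s + n) * ordinaryHypergeometricCoefficient s 1 1 n := by
    refine mul_left_cancel₀ (Nat.cast_add_one_ne_zero n : (n : K) + 1 ≠ 0) ?_
    linear_combination ordinaryHypergeometricCoefficient_succ s 1 1 h1 n
  ext n
  rw [sub_mul, one_mul, map_sub, coeff_C_mul, coeff_derivative, coeff_mk, coeff_mk]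
  cases n with
  | zero =>
    have := key 0
    rw [coeff_zero_X_mul]
    push_cast at this ⊢
    linear_combination this
  | succ n =>
    have := key (n + 1)
    rw [coeff_succ_X_mul, coeff_derivative, coeff_mk]
    push_cast at this ⊢
    linear_combination this

/-- Euler's transformation as an identity of formal power series. -/
theorem mk_ordinaryHypergeometricCoefficient_euler [CharZero K] (a b c : K)
    (hc : ∀ m : ℕ, c ≠ -(m : K)) :
    mk (ordinaryHypergeometricCoefficient (-(c - a - b)) 1 1) *
        mk (ordinaryHypergeometricCoefficient (c - a) (c - b) c) =
      mk (ordinaryHypergeometricCoefficient a b c) := by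
  have hp := one_sub_X_mul_derivative_mk_ordinaryHypergeometricCoefficient (-(c - a - b))
  obtain ⟨hv0, hv⟩ := (eq_mk_ordinaryHypergeometricCoefficient_iff (c - a) (c - b) c hc _).mp rfl
  have hp0 : constantCoeff (mk (ordinaryHypergeometricCoefficient (-(c - a - b)) 1 1)) = 1 := by
    rw [← coeff_zero_eq_constantCoeff_apply, coeff_mk, ordinaryHypergeometricCoefficient_zero]
  set p := mk (ordinaryHypergeometricCoefficient (-(c - a - b)) 1 1)
  set v := mk (ordinaryHypergeometricCoefficient (c - a) (c - b) c)
  rw [eq_mk_ordinaryHypergeometricCoefficient_iff a b c hc]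
  refine ⟨by rw [map_mul, hp0, hv0, one_mul], ?_⟩
  have hp' : (1 - X) * d⁄dX K (d⁄dX K p) - d⁄dX K p = C (-(c - a - b)) * d⁄dX K p := by
    have h := congrArg (d⁄dX K) hp
    simp only [Derivation.leibniz, smul_eq_mul, map_sub (d⁄dX K), derivative_X, derivative_C,
      derivative_one] at h
    linear_combination h
  have hX : (1 - X : K⟦X⟧) ≠ 0 := fun h ↦ by
    simpa using congrArg (constantCoeff (R := K)) h
  refine (mul_eq_zero.mp ?_).resolve_left hX
  simp only [hypergeometricOperator, map_sub, map_neg, Derivation.leibniz, smul_eq_mul,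
    map_add] at hp hp' hv ⊢
  linear_combination X * (1 - X) * v * hp' + (X * (C a + C b - C c + 1) * v
    + 2 * X * (1 - X) * d⁄dX K v + (C c - (C a + C b + 1) * X) * v) * hp + (1 - X) * p * hv

end PowerSeriesIdentity

theorem summable_norm_ordinaryHypergeometricCoefficient_mul_pow (a b c x : ℂ) (hx : ‖x‖ < 1) :
    Summable fun n ↦ ‖ordinaryHypergeometricCoefficient a b c n * x ^ n‖ := by
  have hr : 1 ≤ (ordinaryHypergeometricSeries ℂ a b c).radius := by
    by_cases h : ∀ k : ℕ, (k : ℂ) ≠ -a ∧ (k : ℂ) ≠ -b ∧ (k : ℂ) ≠ -c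
    · rw [ordinaryHypergeometricSeries_radius_eq_one ℂ a b c h]
    · obtain ⟨k, hk⟩ := not_forall.mp h
      have hk : a = -(k : ℂ) ∨ b = -(k : ℂ) ∨ c = -(k : ℂ) := by grind
      rcases hk with rfl | rfl | rfl
      · simp [ordinaryHypergeometric_radius_top_of_neg_nat₁]
      · simp [ordinaryHypergeometric_radius_top_of_neg_nat₂]
      · simp [ordinaryHypergeometric_radius_top_of_neg_nat₃]
  have hmem : x ∈ Metric.eball (0 : ℂ) (ordinaryHypergeometricSeries ℂ a b c).radius := by
    refine Metric.eball_subset_eball hr ?_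
    rw [← ENNReal.ofReal_one, Metric.eball_ofReal]
    simpa using hx
  simpa only [ordinaryHypergeometricSeries, FormalMultilinearSeries.ofScalars_apply_eq,
    smul_eq_mul] using (ordinaryHypergeometricSeries ℂ a b c).summable_norm_apply hmem

theorem hyp2F1_eq_tsum (a b c x : ℂ) :
    hyp2F1 a b c x = ∑' n, ordinaryHypergeometricCoefficient a b c n * x ^ n :=
  tsum_congr fun n ↦ by
    simp only [ordinaryHypergeometricCoefficient, div_eq_mul_inv]
    ring

theorem one_sub_cpow_eq_tsum (s x : ℂ) (hx : ‖x‖ < 1) :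
    (1 - x) ^ s = ∑' n, ordinaryHypergeometricCoefficient (-s) 1 1 n * x ^ n := by
  have hmem : -x ∈ Metric.eball (0 : ℂ) 1 := by
    rw [← ENNReal.ofReal_one, Metric.eball_ofReal]
    simpa using hx
  have h := (one_add_cpow_hasFPowerSeriesOnBall_zero (a := s)).sum hmem
  rw [zero_add, ← sub_eq_add_neg] at h
  rw [h, FormalMultilinearSeries.sum, binomialSeries_eq_ordinaryHypergeometricSeries (b := 1)
    (by norm_cast; simp)]
  refine tsum_congr fun n ↦ ?_
  rw [FormalMultilinearSeries.compContinuousLinearMap_apply]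
  simp only [Function.comp_def, neg_apply, ContinuousLinearMap.id_apply, neg_neg,
    ordinaryHypergeometricSeries, FormalMultilinearSeries.ofScalars_apply_eq, smul_eq_mul]

theorem euler_transformation (a b c x : ℂ)
    (hc : ∀ m : ℕ, c ≠ -(m : ℂ)) (hx : ‖x‖ < 1) :
    hyp2F1 a b c x = (1 - x) ^ (c - a - b) * hyp2F1 (c - a) (c - b) c x := by
  rw [one_sub_cpow_eq_tsum _ x hx, hyp2F1_eq_tsum, hyp2F1_eq_tsum,
    tsum_mul_tsum_eq_tsum_sum_antidiagonal_of_summable_norm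
      (summable_norm_ordinaryHypergeometricCoefficient_mul_pow _ _ _ x hx)
      (summable_norm_ordinaryHypergeometricCoefficient_mul_pow _ _ _ x hx)]
  refine tsum_congr fun n ↦ ?_
  have h := congrArg (PowerSeries.coeff n) (mk_ordinaryHypergeometricCoefficient_euler a b c hc)
  simp only [PowerSeries.coeff_mul, PowerSeries.coeff_mk] at h
  rw [← h, Finset.sum_mul]
  refine Finset.sum_congr rfl fun kl hkl ↦ ?_
  rw [← Finset.HasAntidiagonal.mem_antidiagonal.mp hkl, pow_add]
  ring
end

section
/- Let a, b, c be real numbers with c > 0 and b² − a²c > 0, and set x₋ = (b − √(b²−a²c))/c and x₊ = (b + √(b²−a²c))/c. For a natural number n define G(n) = ∫_{x₋}^{x₊} xⁿ/√(2bx − cx² − a²) dx. Then for every natural number n ≥ 1, n·a²·G(n−1) = (2n+1)·b·G(n) − (n+1)·c·G(n+1). -/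
open intervalIntegral Real

/-- The quadratic `2bx - cx² - a²` is positive strictly between its roots. -/
lemma quadratic_pos_of_mem_Ioo {a b c x : ℝ} (hc : 0 < c) (hd : 0 < b ^ 2 - a ^ 2 * c)
    (hx : x ∈ Set.Ioo ((b - √(b ^ 2 - a ^ 2 * c)) / c) ((b + √(b ^ 2 - a ^ 2 * c)) / c)) :
    0 < 2 * b * x - c * x ^ 2 - a ^ 2 := by
  obtain ⟨h₁, h₂⟩ := hx
  rw [div_lt_iff₀ hc] at h₁
  rw [lt_div_iff₀ hc] at h₂
  have hs := Real.sq_sqrt hd.le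
  have h : 0 < c * (2 * b * x - c * x ^ 2 - a ^ 2) := by
    nlinarith [mul_pos (sub_pos.2 h₁) (sub_pos.2 h₂)]
  exact pos_of_mul_pos_right h hc.le

lemma quadratic_root_sub {a b c : ℝ} (hc : 0 < c) (hd : 0 < b ^ 2 - a ^ 2 * c) :
    2 * b * ((b - √(b ^ 2 - a ^ 2 * c)) / c) - c * ((b - √(b ^ 2 - a ^ 2 * c)) / c) ^ 2
      - a ^ 2 = 0 := by
  have hs := Real.sq_sqrt hd.le
  field_simp
  linear_combination -hs

lemma quadratic_root_add {a b c : ℝ} (hc : 0 < c) (hd : 0 < b ^ 2 - a ^ 2 * c) :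
    2 * b * ((b + √(b ^ 2 - a ^ 2 * c)) / c) - c * ((b + √(b ^ 2 - a ^ 2 * c)) / c) ^ 2
      - a ^ 2 = 0 := by
  have hs := Real.sq_sqrt hd.le
  field_simp
  linear_combination -hs

/-- On the interval between the roots, an antiderivative of `1 / √(2bx - cx² - a²)`
is a rescaled arcsine. -/
lemma hasDerivAt_arcsin_quadratic {a b c x : ℝ} (hc : 0 < c) (hd : 0 < b ^ 2 - a ^ 2 * c)
    (hQ : 0 < 2 * b * x - c * x ^ 2 - a ^ 2) :
    HasDerivAt (fun y => arcsin ((c * y - b) / √(b ^ 2 - a ^ 2 * c)) / √c)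
      (1 / √(2 * b * x - c * x ^ 2 - a ^ 2)) x := by
  have hD := Real.sqrt_pos.2 hd
  have hs := Real.sq_sqrt hd.le
  have hsc := Real.sqrt_pos.2 hc
  have hcc := Real.sq_sqrt hc.le
  have hsQ := Real.sqrt_pos.2 hQ
  have hsub : 1 - ((c * x - b) / √(b ^ 2 - a ^ 2 * c)) ^ 2 =
      (√c * √(2 * b * x - c * x ^ 2 - a ^ 2) / √(b ^ 2 - a ^ 2 * c)) ^ 2 := by
    rw [div_pow, div_pow, mul_pow, hcc, Real.sq_sqrt hQ.le, hs, eq_div_iff hd.ne', sub_mul,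
      div_mul_cancel₀ _ hd.ne']
    ring
  have hpos : 0 < 1 - ((c * x - b) / √(b ^ 2 - a ^ 2 * c)) ^ 2 := by
    rw [hsub]; positivity
  have hlin : HasDerivAt (fun y => (c * y - b) / √(b ^ 2 - a ^ 2 * c))
      (c / √(b ^ 2 - a ^ 2 * c)) x := by
    simpa using (((hasDerivAt_id x).const_mul c).sub_const b).div_const (√(b ^ 2 - a ^ 2 * c))
  have h := ((hasDerivAt_arcsin (by intro h; rw [h] at hpos; norm_num at hpos)
    (by intro h; rw [h] at hpos; norm_num at hpos)).comp x hlin).div_const (√c)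
  refine h.congr_deriv ?_
  rw [hsub, Real.sqrt_sq (by positivity)]
  generalize √(2 * b * x - c * x ^ 2 - a ^ 2) = q at hsQ ⊢
  generalize √(b ^ 2 - a ^ 2 * c) = d at hD ⊢
  field_simp
  exact hcc.symm

lemma intervalIntegrable_pow_div_sqrt_quadratic {a b c : ℝ} (hc : 0 < c)
    (hd : 0 < b ^ 2 - a ^ 2 * c) (m : ℕ) :
    IntervalIntegrable (fun x => x ^ m / √(2 * b * x - c * x ^ 2 - a ^ 2)) MeasureTheory.volume
      ((b - √(b ^ 2 - a ^ 2 * c)) / c) ((b + √(b ^ 2 - a ^ 2 * c)) / c) := by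
  have hle : (b - √(b ^ 2 - a ^ 2 * c)) / c ≤ (b + √(b ^ 2 - a ^ 2 * c)) / c := by
    gcongr
    linarith [Real.sqrt_nonneg (b ^ 2 - a ^ 2 * c)]
  have h : IntervalIntegrable (fun x => 1 / √(2 * b * x - c * x ^ 2 - a ^ 2))
      MeasureTheory.volume
      ((b - √(b ^ 2 - a ^ 2 * c)) / c) ((b + √(b ^ 2 - a ^ 2 * c)) / c) := by
    refine intervalIntegrable_deriv_of_nonneg
      (g := fun y => arcsin ((c * y - b) / √(b ^ 2 - a ^ 2 * c)) / √c) ?_ ?_ ?_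
    · exact ((continuous_arcsin.comp (by fun_prop)).div_const _).continuousOn
    · rw [min_eq_left hle, max_eq_right hle]
      exact fun x hx => hasDerivAt_arcsin_quadratic hc hd (quadratic_pos_of_mem_Ioo hc hd hx)
    · intro x _
      positivity
  simpa [div_eq_mul_inv] using h.continuousOn_mul (continuous_pow m).continuousOn

theorem euler_continued_fraction_recurrence (a b c : ℝ) (hc : 0 < c)
    (hd : 0 < b ^ 2 - a ^ 2 * c)
    (G : ℕ → ℝ)
    (hG : ∀ m : ℕ, G m =
      ∫ x in ((b - Real.sqrt (b ^ 2 - a ^ 2 * c)) / c)..((b + Real.sqrt (b ^ 2 - a ^ 2 * c)) / c),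
        x ^ m / Real.sqrt (2 * b * x - c * x ^ 2 - a ^ 2))
    (n : ℕ) (hn : 1 ≤ n) :
    (n : ℝ) * a ^ 2 * G (n - 1) =
      (2 * (n : ℝ) + 1) * b * G n - ((n : ℝ) + 1) * c * G (n + 1) := by
  obtain ⟨k, rfl⟩ := Nat.exists_eq_add_of_le' hn
  rw [Nat.add_sub_cancel]
  have hle : (b - √(b ^ 2 - a ^ 2 * c)) / c ≤ (b + √(b ^ 2 - a ^ 2 * c)) / c := by
    gcongr
    linarith [Real.sqrt_nonneg (b ^ 2 - a ^ 2 * c)]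
  have hI := intervalIntegrable_pow_div_sqrt_quadratic hc hd
  have i₁ := (hI (k + 1)).const_mul ((2 * ((k + 1 : ℕ) : ℝ) + 1) * b)
  have i₂ := (hI (k + 1 + 1)).const_mul ((((k + 1 : ℕ) : ℝ) + 1) * c)
  have i₀ := (hI k).const_mul (((k + 1 : ℕ) : ℝ) * a ^ 2)
  have key := integral_eq_sub_of_hasDerivAt_of_le
    (f := fun x => x ^ (k + 1) * √(2 * b * x - c * x ^ 2 - a ^ 2)) hle
    (by fun_prop) (fun x hx => ?_) ((i₁.sub i₂).sub i₀)
  · rw [integral_sub (i₁.sub i₂) i₀, integral_sub i₁ i₂] at key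
    simp only [integral_const_mul, ← hG, quadratic_root_sub hc hd, quadratic_root_add hc hd,
      Real.sqrt_zero, mul_zero, sub_zero] at key
    linarith
  · have hQ := quadratic_pos_of_mem_Ioo hc hd hx
    have hsQ := Real.sqrt_pos.2 hQ
    have hq : HasDerivAt (fun y => 2 * b * y - c * y ^ 2 - a ^ 2) (2 * b - c * (2 * x)) x := by
      simpa using (((hasDerivAt_id x).const_mul (2 * b)).sub
        ((hasDerivAt_pow 2 x).const_mul c)).sub_const (a ^ 2)
    have h := (hasDerivAt_pow (k + 1) x).mul (hq.sqrt hQ.ne')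
    refine h.congr_deriv ?_
    have hs := Real.sq_sqrt hQ.le
    rw [Nat.add_sub_cancel]
    push_cast
    generalize √(2 * b * x - c * x ^ 2 - a ^ 2) = q at hsQ hs ⊢
    field_simp
    rw [hs]
    ring
end

section
/- For every real number t > 1 and every natural number n, Pₙ(t) = (1/π)·∫_{t−√(t²−1)}^{t+√(t²−1)} xⁿ/√(2xt − x² − 1) dx. -/
open intervalIntegral

theorem hasDerivAt_sub_mul_cos (t s θ : ℝ) :
    HasDerivAt (fun θ : ℝ => t - s * Real.cos θ) (s * Real.sin θ) θ := by
  simpa using ((Real.hasDerivAt_cos θ).const_mul s).const_sub t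

/-- Laplace's integral satisfies the three-term recurrence of the Legendre polynomials. -/
theorem laplaceIntegral_recurrence (t s : ℝ) (hs : s ^ 2 = t ^ 2 - 1) (n : ℕ) :
    ((n : ℝ) + 2) * ∫ θ in (0 : ℝ)..Real.pi, (t - s * Real.cos θ) ^ (n + 2) =
      (2 * (n : ℝ) + 3) * t * (∫ θ in (0 : ℝ)..Real.pi, (t - s * Real.cos θ) ^ (n + 1)) -
        ((n : ℝ) + 1) * ∫ θ in (0 : ℝ)..Real.pi, (t - s * Real.cos θ) ^ n := by
  have hint : ∀ (c : ℝ) (k : ℕ), IntervalIntegrable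
      (fun θ : ℝ => c * (t - s * Real.cos θ) ^ k) MeasureTheory.volume 0 Real.pi := fun c k =>
    Continuous.intervalIntegrable (by fun_prop) _ _
  have hderiv : ∀ θ : ℝ, HasDerivAt
      (fun θ : ℝ => (t - s * Real.cos θ) ^ (n + 1) * (s * Real.sin θ))
      ((2 * (n : ℝ) + 3) * t * (t - s * Real.cos θ) ^ (n + 1)
        - ((n : ℝ) + 1) * (t - s * Real.cos θ) ^ n
        - ((n : ℝ) + 2) * (t - s * Real.cos θ) ^ (n + 2)) θ := by
    intro θ
    refine (((hasDerivAt_sub_mul_cos t s θ).fun_pow (n + 1)).fun_mul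
      ((Real.hasDerivAt_sin θ).const_mul s)).congr_deriv ?_
    simp only [Nat.add_sub_cancel]
    push_cast
    linear_combination ((n + 1) * (t - s * Real.cos θ) ^ n) *
      (s ^ 2 * Real.sin_sq_add_cos_sq θ + hs)
  have h := integral_eq_sub_of_hasDerivAt (a := 0) (b := Real.pi) (fun θ _ => hderiv θ)
    (Continuous.intervalIntegrable (by fun_prop) _ _)
  rw [integral_sub ((hint _ _).sub (hint _ _)) (hint _ _), integral_sub (hint _ _) (hint _ _),
    integral_const_mul, integral_const_mul, integral_const_mul] at h
  simp only [Real.sin_pi, Real.sin_zero, mul_zero, sub_zero] at h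
  linarith

/-- Laplace's first integral for the Legendre polynomials. -/
theorem pi_mul_legendreP_eq_laplaceIntegral (t s : ℝ) (hs : s ^ 2 = t ^ 2 - 1) (n : ℕ) :
    Real.pi * legendreP n t = ∫ θ in (0 : ℝ)..Real.pi, (t - s * Real.cos θ) ^ n := by
  induction n using Nat.twoStepInduction with
  | zero => simp [legendreP]
  | one =>
    simp only [legendreP, pow_one]
    rw [integral_sub (by simp) (Continuous.intervalIntegrable (by fun_prop) _ _)]
    simp
  | more n ih₀ ih₁ =>
    have h := laplaceIntegral_recurrence t s hs n
    rw [← ih₀, ← ih₁] at h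
    have hn : (n : ℝ) + 2 ≠ 0 := by positivity
    apply mul_left_cancel₀ hn
    rw [h, legendreP]
    have hn' : (n : ℝ) + 1 + 1 ≠ 0 := by positivity
    field_simp
    ring

/-- The substitution `x = t - s cos θ`. -/
theorem integral_pow_div_sqrt_eq_laplaceIntegral (t s : ℝ) (hs : s ^ 2 = t ^ 2 - 1)
    (hs₀ : 0 < s) (n : ℕ) :
    ∫ x in (t - s)..(t + s), x ^ n / Real.sqrt (2 * x * t - x ^ 2 - 1) =
      ∫ θ in (0 : ℝ)..Real.pi, (t - s * Real.cos θ) ^ n := by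
  have hsub := integral_comp_mul_deriv_of_deriv_nonneg (a := 0) (b := Real.pi)
    (f := fun θ : ℝ => t - s * Real.cos θ) (f' := fun θ => s * Real.sin θ)
    (g := fun x : ℝ => x ^ n / Real.sqrt (2 * x * t - x ^ 2 - 1))
    (by fun_prop) (fun θ _ => hasDerivAt_sub_mul_cos t s θ)
    (fun θ hθ => by
      rw [min_eq_left Real.pi_pos.le, max_eq_right Real.pi_pos.le] at hθ
      exact mul_nonneg hs₀.le (Real.sin_nonneg_of_mem_Icc ⟨hθ.1.le, hθ.2.le⟩))
  simp only [Real.cos_zero, Real.cos_pi, mul_one, mul_neg, sub_neg_eq_add] at hsub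
  rw [← hsub]
  apply integral_congr_Ioo_of_le Real.pi_pos.le
  intro θ hθ
  have hpos : 0 < s * Real.sin θ := mul_pos hs₀ (Real.sin_pos_of_mem_Ioo hθ)
  have hsq : 2 * (t - s * Real.cos θ) * t - (t - s * Real.cos θ) ^ 2 - 1
      = (s * Real.sin θ) ^ 2 := by
    linear_combination -s ^ 2 * Real.sin_sq_add_cos_sq θ - hs
  simp only [Function.comp_apply]
  rw [hsq, Real.sqrt_sq hpos.le, div_mul_cancel₀ _ hpos.ne']

theorem legendre_euler_integral_representation (t : ℝ) (ht : 1 < t) (n : ℕ) :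
    legendreP n t =
      (1 / Real.pi) *
        ∫ x in (t - Real.sqrt (t ^ 2 - 1))..(t + Real.sqrt (t ^ 2 - 1)),
          x ^ n / Real.sqrt (2 * x * t - x ^ 2 - 1) := by
  have hpos : 0 < t ^ 2 - 1 := by nlinarith
  have hs := Real.sq_sqrt hpos.le
  rw [integral_pow_div_sqrt_eq_laplaceIntegral t _ hs (Real.sqrt_pos.2 hpos),
    ← pi_mul_legendreP_eq_laplaceIntegral t _ hs, one_div, inv_mul_cancel_left₀ Real.pi_ne_zero]
end

section
/- Let t be a real number with −1 < t < 1 and let n be a natural number. Then there exists a real polynomial Q (in one variable, with coefficients depending on t) such that for every real number x, the function F(x) = Pₙ(t)·artanh((x − t)/√(1 − 2xt + x²)) + Q(x)·√(1 − 2xt + x²) is differentiable at x with derivative F′(x) = xⁿ/√(1 − 2xt + x²). -/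
/-- The inverse hyperbolic tangent, `artanh x = (1/2) * log ((1 + x)/(1 - x))`. -/
noncomputable def artanh (x : ℝ) : ℝ := (1 / 2) * Real.log ((1 + x) / (1 - x))

theorem quadratic_pos {t : ℝ} (ht : -1 < t) (ht' : t < 1) (x : ℝ) :
    0 < 1 - 2 * x * t + x ^ 2 := by
  nlinarith [sq_nonneg (x - t), mul_pos (by linarith : 0 < 1 + t) (by linarith : 0 < 1 - t)]

theorem hasDerivAt_artanh {y : ℝ} (hy : -1 < y) (hy' : y < 1) :
    HasDerivAt artanh (1 / (1 - y ^ 2)) y := by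
  have h₁ : 0 < 1 + y := by linarith
  have h₂ : 0 < 1 - y := by linarith
  have h := ((((hasDerivAt_id y).const_add 1).div ((hasDerivAt_id y).const_sub 1)
    h₂.ne').log (div_pos h₁ h₂).ne').const_mul (1 / 2)
  refine h.congr_deriv ?_
  have h₃ : 1 - y ^ 2 ≠ 0 := by nlinarith [mul_pos h₁ h₂]
  simp only [id, Pi.div_apply]
  field_simp
  ring

theorem hasDerivAt_sqrt_quadratic {t : ℝ} (ht : -1 < t) (ht' : t < 1) (x : ℝ) :
    HasDerivAt (fun x : ℝ => Real.sqrt (1 - 2 * x * t + x ^ 2))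
      ((x - t) / Real.sqrt (1 - 2 * x * t + x ^ 2)) x := by
  have h : HasDerivAt (fun x : ℝ => 1 - 2 * x * t + x ^ 2) (2 * (x - t)) x := by
    have h := ((((hasDerivAt_id x).const_mul 2).mul_const t).const_sub 1).add (hasDerivAt_pow 2 x)
    refine h.congr_deriv ?_
    norm_num
    ring
  exact (h.sqrt (quadratic_pos ht ht' x).ne').congr_deriv (mul_div_mul_left _ _ two_ne_zero)

theorem hasDerivAt_artanh_div_sqrt {t : ℝ} (ht : -1 < t) (ht' : t < 1) (x : ℝ) :
    HasDerivAt (fun x : ℝ => artanh ((x - t) / Real.sqrt (1 - 2 * x * t + x ^ 2)))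
      (1 / Real.sqrt (1 - 2 * x * t + x ^ 2)) x := by
  have hR := quadratic_pos ht ht' x
  have hs := Real.sqrt_pos.2 hR
  have hsq := Real.sq_sqrt hR.le
  have hd := hasDerivAt_sqrt_quadratic ht ht' x
  have ht₂ : 0 < 1 - t ^ 2 := by nlinarith
  have hlt : |x - t| < Real.sqrt (1 - 2 * x * t + x ^ 2) :=
    Real.lt_sqrt_of_sq_lt (by rw [sq_abs]; linarith)
  obtain ⟨h₁, h₂⟩ := abs_lt.1 hlt
  have hy : -1 < (x - t) / Real.sqrt (1 - 2 * x * t + x ^ 2) := by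
    rw [lt_div_iff₀ hs]; linarith
  have hy' : (x - t) / Real.sqrt (1 - 2 * x * t + x ^ 2) < 1 := by
    rw [div_lt_one hs]; exact h₂
  have h := (hasDerivAt_artanh hy hy').comp x (((hasDerivAt_id x).sub_const t).div hd hs.ne')
  refine h.congr_deriv ?_
  simp only [id]
  generalize Real.sqrt (1 - 2 * x * t + x ^ 2) = s at hs hsq
  have h₃ : s ^ 2 - (x - t) ^ 2 ≠ 0 := by rw [hsq]; nlinarith
  have h₄ : 1 - ((x - t) / s) ^ 2 = (s ^ 2 - (x - t) ^ 2) / s ^ 2 := by field_simp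
  rw [h₄]
  field_simp

/-- The polynomial cofactor of the square root, built by the inhomogeneous form of the
Legendre recurrence. -/
theorem exists_polynomial_legendreP_add (t : ℝ) (n : ℕ) :
    ∃ Q : Polynomial ℝ, ∀ x : ℝ,
      legendreP n t + Q.derivative.eval x * (1 - 2 * x * t + x ^ 2) + Q.eval x * (x - t)
        = x ^ n := by
  induction n using Nat.twoStepInduction with
  | zero => exact ⟨0, by simp [legendreP]⟩
  | one => exact ⟨1, by simp [legendreP]⟩
  | more n ih₀ ih₁ =>
    obtain ⟨Q₀, h₀⟩ := ih₀
    obtain ⟨Q₁, h₁⟩ := ih₁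
    refine ⟨Polynomial.C (1 / (n + 2 : ℝ)) * (Polynomial.X ^ (n + 1)
      + Polynomial.C ((2 * n + 3) * t) * Q₁ - Polynomial.C (n + 1 : ℝ) * Q₀), fun x => ?_⟩
    have hn : (n + 2 : ℝ) ≠ 0 := by positivity
    simp only [legendreP, Polynomial.derivative_mul, Polynomial.derivative_C,
      Polynomial.derivative_sub, Polynomial.derivative_add, Polynomial.derivative_X_pow,
      Polynomial.eval_add, Polynomial.eval_sub, Polynomial.eval_mul, Polynomial.eval_C,
      Polynomial.eval_pow, Polynomial.eval_X, Polynomial.eval_zero, Nat.add_sub_cancel]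
    push_cast
    rw [show (n + 1 + 1 : ℝ) = n + 2 by ring]
    field_simp
    linear_combination (2 * n + 3) * t * h₁ x - (n + 1) * h₀ x

theorem euler_antiderivative (t : ℝ) (ht : -1 < t) (ht' : t < 1) (n : ℕ) :
    ∃ Q : Polynomial ℝ, ∀ x : ℝ,
      HasDerivAt
        (fun x : ℝ =>
          legendreP n t * artanh ((x - t) / Real.sqrt (1 - 2 * x * t + x ^ 2)) +
            Q.eval x * Real.sqrt (1 - 2 * x * t + x ^ 2))
        (x ^ n / Real.sqrt (1 - 2 * x * t + x ^ 2)) x := by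
  obtain ⟨Q, hQ⟩ := exists_polynomial_legendreP_add t n
  refine ⟨Q, fun x => ?_⟩
  have hR := quadratic_pos ht ht' x
  refine (((hasDerivAt_artanh_div_sqrt ht ht' x).const_mul (legendreP n t)).add
    ((Q.hasDerivAt x).mul (hasDerivAt_sqrt_quadratic ht ht' x))).congr_deriv ?_
  have hs := Real.sqrt_pos.2 hR
  have hsq := Real.sq_sqrt hR.le
  rw [← hQ x]
  generalize Real.sqrt (1 - 2 * x * t + x ^ 2) = s at hs hsq
  rw [← hsq]
  field_simp
  ring
end

section
/- Let a, b, c be real numbers and for each natural number n let Bₙ denote the coefficient of Xⁿ in the polynomial (a + bX + cX²)ⁿ ∈ ℝ[X]. Then there exists ε > 0 such that for every real x with |x| < ε, one has 1 − 2bx + (b² − 4ac)x² > 0 and the series ∑_{n=0}^∞ Bₙ·xⁿ converges to 1/√(1 − 2bx + (b² − 4ac)x²). -/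
open Polynomial

/-- The coefficient of `Xⁿ` in `(P + bX)ⁿ` is the binomial transform of the coefficients of `Xʲ` in
`Pʲ`. -/
lemma coeff_add_C_mul_X_pow (P : ℝ[X]) (b : ℝ) (n : ℕ) :
    ((P + C b * X) ^ n).coeff n =
      ∑ j ∈ Finset.range (n + 1), (n.choose j : ℝ) * (P ^ j).coeff j * b ^ (n - j) := by
  rw [add_pow, finsetSum_coeff]
  refine Finset.sum_congr rfl fun j hj => ?_
  have hjn : j ≤ n := Nat.lt_succ_iff.mp (Finset.mem_range.mp hj)
  have hP : P ^ j * (C b * X) ^ (n - j) * ((n.choose j : ℕ) : ℝ[X]) =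
      C ((n.choose j : ℝ) * b ^ (n - j)) * P ^ j * X ^ (n - j) := by
    simp only [mul_pow, map_mul, map_pow, map_natCast]
    ring
  rw [hP, coeff_mul_X_pow', if_pos (Nat.sub_le n j), Nat.sub_sub_self hjn, coeff_C_mul]
  ring

lemma coeff_C_add_C_mul_X_pow (a c : ℝ) {n k : ℕ} (hk : k ≤ n) :
    ((C a + C c * X) ^ n).coeff k = (n.choose k : ℝ) * c ^ k * a ^ (n - k) := by
  have h : ∀ m, (C c * X) ^ m * C a ^ (n - m) * ((n.choose m : ℕ) : ℝ[X]) =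
      C ((n.choose m : ℝ) * c ^ m * a ^ (n - m)) * X ^ m := by
    intro m
    simp only [mul_pow, map_mul, map_pow, map_natCast]
    ring
  rw [add_comm, add_pow, finsetSum_coeff]
  simp only [h, coeff_C_mul_X_pow]
  rw [Finset.sum_ite_eq, if_pos (Finset.mem_range.mpr (by omega))]

lemma coeff_C_add_C_mul_X_sq_pow (a c : ℝ) (n : ℕ) :
    ((C a + C c * X ^ 2) ^ n).coeff n =
      if 2 ∣ n then ((C a + C c * X) ^ n).coeff (n / 2) else 0 := by
  have h : (C a + C c * X ^ 2) ^ n = expand ℝ 2 ((C a + C c * X) ^ n) := by simp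
  rw [h, coeff_expand two_pos]

lemma choose_neg_half_mul_pow (k : ℕ) :
    Ring.choose (-1 / 2 : ℝ) k * (-4) ^ k = k.centralBinom := by
  induction k with
  | zero => simp
  | succ k ih =>
    have h := Ring.choose_smul_choose (-1 / 2 : ℝ) (Nat.le_succ k)
    simp only [Nat.succ_eq_add_one, Nat.add_sub_cancel_left, Ring.choose_one_right,
      Nat.choose_succ_self_right, nsmul_eq_mul] at h
    have hc : ((k : ℝ) + 1) * (k + 1).centralBinom = 2 * (2 * k + 1) * k.centralBinom := by
      exact_mod_cast Nat.succ_mul_centralBinom_succ k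
    refine mul_left_cancel₀ (Nat.cast_add_one_ne_zero (R := ℝ) k) ?_
    rw [hc, ← ih]
    push_cast at h
    linear_combination (-4) ^ (k + 1) * h

lemma hasSum_centralBinom_mul_pow {y : ℝ} (hy : |4 * y| < 1) :
    HasSum (fun k : ℕ => (k.centralBinom : ℝ) * y ^ k) (1 / √(1 - 4 * y)) := by
  have hmem : -4 * y ∈ Metric.eball (0 : ℝ) 1 := by
    rw [← ENNReal.ofReal_one, Metric.eball_ofReal]
    simpa [abs_mul] using hy
  have h := (Real.one_add_rpow_hasFPowerSeriesOnBall_zero (a := -1 / 2)).hasSum hmem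
  have hpos : 0 ≤ 1 - 4 * y := by linarith [(abs_lt.mp hy).2]
  convert! h using 1
  · funext k
    rw [binomialSeries_apply, ← choose_neg_half_mul_pow]
    rw [List.ofFn_const, List.prod_replicate, mul_pow, smul_eq_mul, mul_assoc]
  · rw [zero_add, show 1 + -4 * y = 1 - 4 * y by ring, show (-1 / 2 : ℝ) = -(1 / 2) by ring,
      Real.rpow_neg hpos, ← Real.sqrt_eq_rpow, one_div]

lemma hasSum_coeff_C_add_C_mul_X_sq_pow (a c : ℝ) {z : ℝ} (hz : |4 * (a * c * z ^ 2)| < 1) :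
    HasSum (fun j : ℕ => ((C a + C c * X ^ 2) ^ j).coeff j * z ^ j)
      (1 / √(1 - 4 * (a * c * z ^ 2))) := by
  have hinj : Function.Injective fun k : ℕ => 2 * k := mul_right_injective₀ two_ne_zero
  rw [← hinj.hasSum_iff]
  · convert hasSum_centralBinom_mul_pow hz using 2 with k
    have hk : 2 * k - k = k := by omega
    simp only [Function.comp_apply, coeff_C_add_C_mul_X_sq_pow, dvd_mul_right, if_true,
      Nat.mul_div_cancel_left k two_pos]
    rw [coeff_C_add_C_mul_X_pow a c (by omega), hk, Nat.centralBinom_eq_two_mul_choose]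
    ring
  · intro j hj
    rw [coeff_C_add_C_mul_X_sq_pow, if_neg, zero_mul]
    rintro ⟨k, rfl⟩
    exact hj ⟨k, rfl⟩

lemma hasSum_choose_mul_pow_mul_pow {b x : ℝ} (hbx : |b * x| < 1) (j : ℕ) :
    HasSum (fun n : ℕ => (n.choose j : ℝ) * b ^ (n - j) * x ^ n)
      (1 / (1 - b * x) * (x / (1 - b * x)) ^ j) := by
  have hne : 1 - b * x ≠ 0 := by linarith [(abs_lt.mp hbx).2]
  have hinj : Function.Injective fun m : ℕ => m + j := add_left_injective j
  rw [← hinj.hasSum_iff]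
  · convert! (hasSum_choose_mul_geometric_of_norm_lt_one j hbx).mul_left (x ^ j) using 1
    · funext m
      simp only [Function.comp_apply, Nat.add_sub_cancel]
      ring
    · rw [div_pow, pow_succ]
      field_simp
  · intro n hn
    have hnj : n < j := by
      by_contra! h
      exact hn ⟨n - j, Nat.sub_add_cancel h⟩
    simp [Nat.choose_eq_zero_of_lt hnj]

/-- Generating function of the binomial transform of a sequence. -/
lemma hasSum_binomial_transform {e : ℕ → ℝ} {b x S : ℝ} (hbx : |b * x| < 1)
    (hS : HasSum (fun j => e j * (x / (1 - b * x)) ^ j) S)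
    (habs : Summable fun j => e j * (|x| / (1 - |b * x|)) ^ j) :
    HasSum (fun n : ℕ =>
      (∑ j ∈ Finset.range (n + 1), (n.choose j : ℝ) * e j * b ^ (n - j)) * x ^ n)
      (1 / (1 - b * x) * S) := by
  set f : ℕ × ℕ → ℝ := fun p => e p.1 * ((p.2.choose p.1 : ℝ) * b ^ (p.2 - p.1) * x ^ p.2) with hf
  have hrow : ∀ j, HasSum (fun n => f (j, n))
      (e j * (1 / (1 - b * x) * (x / (1 - b * x)) ^ j)) := fun j =>
    (hasSum_choose_mul_pow_mul_pow hbx j).mul_left (e j)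
  have habs_row : ∀ j, HasSum (fun n => |f (j, n)|)
      (|e j| * (1 / (1 - |b * x|) * (|x| / (1 - |b * x|)) ^ j)) := by
    intro j
    have h := (hasSum_choose_mul_pow_mul_pow (b := |b|) (x := |x|) (by simpa [abs_mul] using hbx)
      j).mul_left |e j|
    rw [← abs_mul] at h
    simpa [hf, abs_mul] using h
  have hpos : 0 < 1 - |b * x| := sub_pos.mpr hbx
  have hsum : Summable f := by
    refine Summable.of_abs ((summable_prod_of_nonneg fun _ => abs_nonneg _).mpr
      ⟨fun j => (habs_row j).summable, ?_⟩)
    simp only [(habs_row _).tsum_eq]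
    refine (habs.abs.mul_left (1 / (1 - |b * x|))).congr fun j => ?_
    rw [abs_mul (e j), abs_of_nonneg (pow_nonneg (div_nonneg (abs_nonneg x) hpos.le) j)]
    ring
  have htotal : HasSum f (1 / (1 - b * x) * S) := by
    have hcol : HasSum (fun j => e j * (1 / (1 - b * x) * (x / (1 - b * x)) ^ j))
        (1 / (1 - b * x) * S) := by
      simpa only [mul_left_comm] using hS.mul_left (1 / (1 - b * x))
    exact (hsum.hasSum.prod_fiberwise hrow).unique hcol ▸ hsum.hasSum
  refine ((Equiv.prodComm ℕ ℕ).hasSum_iff.mpr htotal).prod_fiberwise fun n => ?_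
  have hcol : HasSum (fun j => f (j, n)) (∑ j ∈ Finset.range (n + 1), f (j, n)) := by
    refine hasSum_sum_of_ne_finset_zero fun j hj => ?_
    have hnj : n < j := by simpa using hj
    simp [hf, Nat.choose_eq_zero_of_lt hnj]
  convert! hcol using 1
  rw [Finset.sum_mul]
  refine Finset.sum_congr rfl fun j _ => ?_
  simp only [hf]
  ring

theorem euler_trinomial_generating_function (a b c : ℝ)
    (B : ℕ → ℝ)
    (hB : ∀ n : ℕ, B n = (((C a + C b * X + C c * X ^ 2 : ℝ[X])) ^ n).coeff n) :
    ∃ ε > 0, ∀ x : ℝ, |x| < ε →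
      1 - 2 * b * x + (b ^ 2 - 4 * a * c) * x ^ 2 > 0 ∧
        HasSum (fun n : ℕ => B n * x ^ n)
          (1 / Real.sqrt (1 - 2 * b * x + (b ^ 2 - 4 * a * c) * x ^ 2)) := by
  set M : ℝ := 1 + |a| + |b| + |c| with hM
  have hMpos : 0 < M := by positivity
  refine ⟨1 / (4 * M), by positivity, fun x hx => ?_⟩
  have hMx : M * |x| < 1 / 4 := by
    rw [lt_div_iff₀ (by positivity)] at hx
    linarith
  have hle : ∀ t : ℝ, |t| ≤ M → |t * x| < 1 / 4 := fun t ht => by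
    rw [abs_mul]
    exact (mul_le_mul_of_nonneg_right ht (abs_nonneg x)).trans_lt hMx
  have hax := hle a (by linarith [abs_nonneg b, abs_nonneg c])
  have hbx := hle b (by linarith [abs_nonneg a, abs_nonneg c])
  have hcx := hle c (by linarith [abs_nonneg a, abs_nonneg b])
  have hbound : ∀ t w : ℝ, |w| = |x| → 3 / 4 < t → |4 * (a * c * (w / t) ^ 2)| < 1 := by
    intro t w hw ht
    have heq : |4 * (a * c * (w / t) ^ 2)| = 4 * (|a * x| * |c * x|) / t ^ 2 := by
      have htpos : 0 < t := by linarith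
      simp only [abs_mul, abs_pow, abs_div, hw, abs_of_pos htpos, Nat.abs_ofNat]
      ring
    rw [heq, div_lt_one (by positivity)]
    nlinarith [mul_lt_mul'' hax hcx (abs_nonneg _) (abs_nonneg _)]
  have hden : 3 / 4 < 1 - b * x := by linarith [(abs_lt.mp hbx).2]
  have hz := hbound (1 - b * x) x rfl hden
  have hdenpos : 0 < 1 - b * x := by linarith
  have hfactor : 1 - 2 * b * x + (b ^ 2 - 4 * a * c) * x ^ 2 =
      (1 - b * x) ^ 2 * (1 - 4 * (a * c * (x / (1 - b * x)) ^ 2)) := by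
    field_simp
    ring
  have hzpos : 0 < 1 - 4 * (a * c * (x / (1 - b * x)) ^ 2) := by linarith [(abs_lt.mp hz).2]
  refine ⟨hfactor ▸ by positivity, ?_⟩
  have h := hasSum_binomial_transform (b := b) (x := x) (by linarith)
    (hasSum_coeff_C_add_C_mul_X_sq_pow a c hz)
    (hasSum_coeff_C_add_C_mul_X_sq_pow a c
      (hbound (1 - |b * x|) |x| (abs_abs x) (by linarith))).summable
  rw [hfactor, Real.sqrt_mul (sq_nonneg _), Real.sqrt_sq hdenpos.le, ← one_div_mul_one_div]
  simpa only [hB, add_right_comm (C a) (C b * X), coeff_add_C_mul_X_pow] using h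
end

section
/- Let t be a real number and for each natural number n let Bₙ(t) denote the coefficient of Xⁿ in the polynomial ((t−1)/2 + t·X + ((t+1)/2)·X²)ⁿ ∈ ℝ[X]. Then for every natural number n ≥ 2, n·Bₙ(t) = (2n−1)·t·B_{n−1}(t) − (n−1)·B_{n−2}(t). -/
open Polynomial

/-- Comparing coefficients of `X ^ m` in the derivative of `p ^ (n + 1)` for a quadratic `p`. -/
lemma succ_mul_coeff_succ_quadratic_pow (a b c : ℝ) (n m : ℕ) :
    ((m : ℝ) + 1) * ((C a + C b * X + C c * X ^ 2 : ℝ[X]) ^ (n + 1)).coeff (m + 1) =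
      ((n : ℝ) + 1) * (b * ((C a + C b * X + C c * X ^ 2 : ℝ[X]) ^ n).coeff m +
        2 * c * (X * (C a + C b * X + C c * X ^ 2 : ℝ[X]) ^ n).coeff m) := by
  set p : ℝ[X] := C a + C b * X + C c * X ^ 2 with hp
  have hd : derivative (p ^ (n + 1)) =
      C ((n : ℝ) + 1) * (C b * p ^ n + C (2 * c) * (X * p ^ n)) := by
    have hdp : derivative p = C b + C (2 * c) * X := by
      simp [hp, show (C 2 : ℝ[X]) = 2 from rfl]
      ring
    rw [derivative_pow_succ, hdp]
    ring
  have h := congrArg (fun q : ℝ[X] => q.coeff m) hd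
  simp only [coeff_derivative, coeff_C_mul, coeff_add] at h
  linarith

/-- Comparing coefficients of `X ^ (m + 1)` in `p ^ (n + 1) = p * p ^ n` for a quadratic `p`. -/
lemma coeff_succ_quadratic_pow_succ (a b c : ℝ) (n m : ℕ) :
    ((C a + C b * X + C c * X ^ 2 : ℝ[X]) ^ (n + 1)).coeff (m + 1) =
      a * ((C a + C b * X + C c * X ^ 2 : ℝ[X]) ^ n).coeff (m + 1) +
        b * ((C a + C b * X + C c * X ^ 2 : ℝ[X]) ^ n).coeff m +
        c * (X * (C a + C b * X + C c * X ^ 2 : ℝ[X]) ^ n).coeff m := by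
  set p : ℝ[X] := C a + C b * X + C c * X ^ 2 with hp
  have h : p ^ (n + 1) = C a * p ^ n + C b * (X * p ^ n) + C c * (X * (X * p ^ n)) := by
    rw [pow_succ]
    nth_rewrite 2 [hp]
    ring
  rw [h]
  simp only [coeff_add, coeff_C_mul, coeff_X_mul]

/-- The central coefficients of the powers of a quadratic in terms of the previous power. -/
lemma central_coeff_quadratic_pow_succ (a b c : ℝ) (n : ℕ) :
    ((C a + C b * X + C c * X ^ 2 : ℝ[X]) ^ (n + 1)).coeff (n + 1) =
      b * ((C a + C b * X + C c * X ^ 2 : ℝ[X]) ^ n).coeff n +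
        2 * a * ((C a + C b * X + C c * X ^ 2 : ℝ[X]) ^ n).coeff (n + 1) := by
  have h₁ := mul_left_cancel₀ (by positivity) (succ_mul_coeff_succ_quadratic_pow a b c n n)
  have h₂ := coeff_succ_quadratic_pow_succ a b c n n
  linarith

theorem euler_trinomial_coeff_recurrence (t : ℝ)
    (B : ℕ → ℝ)
    (hB : ∀ n : ℕ, B n =
      (((C ((t - 1) / 2) + C t * X + C ((t + 1) / 2) * X ^ 2 : ℝ[X])) ^ n).coeff n)
    (n : ℕ) (hn : 2 ≤ n) :
    (n : ℝ) * B n = (2 * (n : ℝ) - 1) * t * B (n - 1) - ((n : ℝ) - 1) * B (n - 2) := by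
  obtain ⟨k, rfl⟩ := Nat.exists_eq_add_of_le' hn
  have h₁ := central_coeff_quadratic_pow_succ ((t - 1) / 2) t ((t + 1) / 2) k
  have h₂ := central_coeff_quadratic_pow_succ ((t - 1) / 2) t ((t + 1) / 2) (k + 1)
  have h₃ := succ_mul_coeff_succ_quadratic_pow ((t - 1) / 2) t ((t + 1) / 2) k (k + 1)
  rw [coeff_X_mul, ← hB] at h₃
  rw [← hB, ← hB] at h₁ h₂
  rw [show k + 2 - 1 = k + 1 by lia, Nat.add_sub_cancel]
  push_cast at h₃ ⊢
  linear_combination ((k : ℝ) + 2) * h₂ + (t - 1) * h₃ - ((k : ℝ) + 1) * t * h₁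
end

section
/- Let t be a real number and for each natural number n let Bₙ(t) denote the coefficient of Xⁿ in the polynomial ((t−1)/2 + t·X + ((t+1)/2)·X²)ⁿ ∈ ℝ[X]. Then Bₙ(t) = Pₙ(t) for every natural number n. -/
open Polynomial

/-- The three-term recurrence for the central coefficients of powers of a trinomial. -/
theorem trinomial_pow_coeff_recurrence {R : Type*} [CommRing R] (a b c : R) (n : ℕ) :
    ((n : R) + 2) * ((C a + C b * X + C c * X ^ 2) ^ (n + 2)).coeff (n + 2) =
      (2 * (n : R) + 3) * b * ((C a + C b * X + C c * X ^ 2) ^ (n + 1)).coeff (n + 1) -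
        ((n : R) + 1) * (b ^ 2 - 4 * a * c) * ((C a + C b * X + C c * X ^ 2) ^ n).coeff n := by
  have key (Q : R[X]) (hQ : Q = C a + C b * X + C c * X ^ 2) :
      X * derivative (Q ^ (n + 1) * (C c * X ^ 2 - C a)) =
        C ((n : R) + 2) * (Q ^ (n + 1) * (C c * X ^ 2 - C a)) + C ((n : R) + 2) * Q ^ (n + 2) -
          C ((2 * (n : R) + 3) * b) * (Q ^ (n + 1) * X) +
          C (((n : R) + 1) * (b ^ 2 - 4 * a * c)) * (Q ^ n * X ^ 2) := by
    have hd : derivative Q = C b + 2 * C c * X := by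
      subst hQ
      simp
      ring
    rw [derivative_mul, derivative_pow, hd]
    simp only [derivative_mul, derivative_C, derivative_X_pow, map_add, map_mul,
      map_sub, map_pow, map_natCast, map_ofNat, map_one, Nat.add_sub_cancel, Nat.cast_add,
      Nat.cast_one, Nat.cast_ofNat, pow_succ Q]
    generalize Q ^ n = P
    subst hQ
    ring
  have h := congrArg (fun p => p.coeff (n + 2)) (key _ rfl)
  generalize C a + C b * X + C c * X ^ 2 = Q at h ⊢
  simp only [coeff_add, coeff_sub, coeff_C_mul, coeff_mul_X_pow, coeff_X_mul, coeff_derivative,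
    show n + 2 = (n + 1) + 1 from rfl, coeff_mul_X] at h
  push_cast at h
  linear_combination -h

theorem legendre_eq_trinomial_coeff (t : ℝ) (n : ℕ) :
    (((C ((t - 1) / 2) + C t * X + C ((t + 1) / 2) * X ^ 2 : ℝ[X])) ^ n).coeff n =
      legendreP n t := by
  induction n using Nat.twoStepInduction with
  | zero => simp [legendreP]
  | one => simp [legendreP, coeff_C]
  | more n ih₀ ih₁ =>
    have h := trinomial_pow_coeff_recurrence ((t - 1) / 2) t ((t + 1) / 2) n
    rw [ih₀, ih₁] at h
    rw [legendreP, eq_div_iff (by positivity)]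
    linear_combination h
end
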